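/- arXiv:2604.21145 — 2 statements merged into one kernel-verified Lean document; each statement's English description precedes it below -/
import Mathlib

section
/- Let (V,E,μ) be an infinite, connected, locally finite weighted graph satisfying condition (p₀), let m>1, fix o∈V, and suppose p ≥ 0 and m−1−p < q < m (region G₁). If there exist constants C>0 and N∈ℕ such that W_o(n) ≤ C·n^{(mp+q)/(p+q−m+1)}·(ln n)^{(m−1)/(p+q−m+1)} for all n ≥ N, then every positive solution of (★) on V is constant; i.e., (★) admits no nontrivial positive solution. -/
variable {V : Type*}

/-- Vertex measure `μ(x) = ∑_{y} μ_{xy}` of a weighted graph. -/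
noncomputable def vMeasure (μ : V → V → ℝ) (x : V) : ℝ := ∑ᶠ y, μ x y

/-- The `m`-Laplacian on a weighted graph. -/
noncomputable def lapM (μ : V → V → ℝ) (m : ℝ) (u : V → ℝ) (x : V) : ℝ :=
  (vMeasure μ x)⁻¹ * ∑ᶠ y, μ x y * |u y - u x| ^ (m - 2) * (u y - u x)

/-- The norm of the gradient on a weighted graph. -/
noncomputable def gradNorm (μ : V → V → ℝ) (u : V → ℝ) (x : V) : ℝ :=
  Real.sqrt (∑ᶠ y, μ x y / (2 * vMeasure μ x) * (u y - u x) ^ 2)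

open Classical in
/-- `W_o(n)`: the sum of `μ_{xy}` over pairs `(x,y)` with `x ∈ B(o,n)`, `y ∈ V`
and `d(o,x) < d(o,y)`. -/
noncomputable def Wvol (G : SimpleGraph V) (μ : V → V → ℝ) (o : V) (n : ℕ) : ℝ :=
  ∑ᶠ x, ∑ᶠ y, if G.dist o x ≤ n ∧ G.dist o x < G.dist o y then μ x y else 0


lemma exists_parent_aux (G : SimpleGraph V) (hconn : G.Connected) (o x : V) (h : 0 < G.dist o x) :
    ∃ y, G.Adj y x ∧ G.dist o x = G.dist o y + 1 := by
  obtain ⟨w, hw⟩ := hconn.exists_walk_length_eq_dist x o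
  cases w with
  | nil => simp at h
  | cons ha w' =>
    rename_i y
    refine ⟨y, ha.symm, ?_⟩
    rw [SimpleGraph.dist_comm] at hw
    simp at hw
    have h1 := SimpleGraph.dist_le w'
    rw [SimpleGraph.dist_comm] at h1
    have h2 := hconn.dist_triangle (u := o) (v := y) (w := x)
    rw [SimpleGraph.dist_eq_one_iff_adj.mpr ha.symm] at h2
    omega


lemma rpow_sub_le_aux {a b s : ℝ} (hb : 0 ≤ b) (hab : b ≤ a) (hs : 1 ≤ s) :
    a ^ s - b ^ s ≤ s * a ^ (s - 1) * (a - b) := by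
  rcases (hb.trans hab).eq_or_lt with h0 | ha
  · have : b = 0 := by linarith
    subst this; subst h0; simp
  have h := one_add_mul_self_le_rpow_one_add (s := b / a - 1) (by
    have : 0 ≤ b / a := by positivity
    linarith) hs
  have e1 : 1 + (b / a - 1) = b / a := by ring
  rw [e1, Real.div_rpow hb ha.le, le_div_iff₀ (by positivity)] at h
  have e2 : a ^ s = a ^ (s - 1) * a := by
    rw [← Real.rpow_add_one ha.ne']; ring_nf
  have e3 : (1 + s * (b / a - 1)) * a ^ s = a ^ s - s * a ^ (s - 1) * (a - b) := by
    have : (b / a) * a = b := by field_simp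
    rw [e2]; linear_combination s * a ^ (s - 1) * this
  linarith

lemma pair_aux {D m s fx fy hx hy : ℝ} (hm : 1 < m) (hs : 1 ≤ s) (hfx : 0 ≤ fx) (hfy : 0 ≤ fy)
    (hhx : 0 ≤ hx) (hhy : 0 ≤ hy) (h1 : 0 ≤ D → hy ≤ hx) (h2 : D ≤ 0 → hx ≤ hy) :
    |D| ^ (m - 2) * D * (fy ^ s * hy - fx ^ s * hx) ≤
      -(fx ^ s * |D| ^ (m - 1) * |hy - hx|)
      + |D| ^ (m - 1) * hy * (s * fx ^ (s - 1) * max (fx - fy) 0)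
      + |D| ^ (m - 1) * hx * (s * fy ^ (s - 1) * max (fy - fx) 0) := by
  rcases eq_or_ne D 0 with h0 | h0
  · subst h0
    simp [Real.zero_rpow (by linarith : m - 1 ≠ 0)]
  have hP : |D| ^ (m - 1) = |D| ^ (m - 2) * |D| := by
    rw [← Real.rpow_add_one (abs_pos.mpr h0).ne']; ring_nf
  have hP0 : 0 ≤ |D| ^ (m - 1) := by positivity
  generalize |D| ^ (m - 1) = P at *
  generalize |D| ^ (m - 2) = Q at *
  suffices H : ∀ σ : ℝ, (σ = 1 ∧ |hy - hx| = hx - hy ∧ hy ≤ hx) ∨ (σ = -1 ∧ |hy - hx| = hy - hx ∧ hx ≤ hy) →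
     σ * (fy ^ s * hy - fx ^ s * hx) ≤ -(fx ^ s * |hy - hx|)
      + hy * (s * fx ^ (s - 1) * max (fx - fy) 0)
      + hx * (s * fy ^ (s - 1) * max (fy - fx) 0) by
    rcases lt_or_gt_of_ne h0 with hD | hD
    · have := mul_le_mul_of_nonneg_left (H (-1) (Or.inr ⟨rfl, abs_of_nonneg (by linarith [h2 hD.le]), h2 hD.le⟩)) hP0
      rw [abs_of_neg hD] at hP
      have e : Q * D = - P := by linarith
      rw [e]; linarith
    · have := mul_le_mul_of_nonneg_left (H 1 (Or.inl ⟨rfl, by rw [abs_of_nonpos (by linarith [h1 hD.le])]; ring, h1 hD.le⟩)) hP0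
      rw [abs_of_pos hD] at hP
      rw [← hP]; linarith
  intro σ hσ
  rcases le_total fy fx with hf | hf
  · have e := rpow_sub_le_aux hfy hf hs
    rw [max_eq_left (by linarith), max_eq_right (by linarith : fy - fx ≤ 0)]
    have e2 := mul_le_mul_of_nonneg_left e hhy
    have e4 : fy ^ s ≤ fx ^ s := Real.rpow_le_rpow hfy hf (by linarith)
    have e5 := mul_le_mul_of_nonneg_left e4 hhy
    rcases hσ with ⟨r, h, h'⟩ | ⟨r, h, h'⟩ <;> rw [r, h] <;> nlinarith
  · have e := rpow_sub_le_aux hfx hf hs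
    rw [max_eq_right (by linarith), max_eq_left (by linarith : 0 ≤ fy - fx)]
    have e2 := mul_le_mul_of_nonneg_left e hhx
    have e4 : fx ^ s ≤ fy ^ s := Real.rpow_le_rpow hfx hf (by linarith)
    have e5 := mul_le_mul_of_nonneg_left e4 hhx
    have e6 := mul_le_mul_of_nonneg_left e4 hhy
    rcases hσ with ⟨r, h, h'⟩ | ⟨r, h, h'⟩ <;> rw [r, h] <;> nlinarith [mul_nonneg (sub_nonneg.2 e4) (sub_nonneg.2 h')]

lemma test_ineq (F : Finset V) (μ : V → V → ℝ)
    (hsymm : ∀ x y, μ x y = μ y x) (hnonneg : ∀ x y, 0 ≤ μ x y)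
    (w g u h φ Gr X : V → ℝ) (m s H K : ℝ) (hm : 1 < m) (hs : 1 < s)
    (hφ : ∀ x, 0 ≤ φ x) (hh : ∀ x, 0 ≤ h x) (hg : ∀ x, 0 ≤ g x) (hGr : ∀ x, 0 ≤ Gr x)
    (hH : 0 ≤ H) (hK : 0 ≤ K)
    (hanti : ∀ x y, u x ≤ u y → h y ≤ h x)
    (hsol : ∀ x ∈ F, φ x ≠ 0 →
      ∑ y ∈ F, μ x y * |u y - u x| ^ (m - 2) * (u y - u x) ≤ - (w x * X x))
    (hw : ∀ x ∈ F, φ x ≠ 0 → ∑ y ∈ F, μ x y ≤ w x)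
    (hK' : ∀ x y, 0 < μ x y → |u y - u x| ≤ K * g x)
    (hH' : ∀ x y, 0 < μ x y → h y ≤ H * h x)
    (hG' : ∀ x y, 0 < μ x y → φ x - φ y ≤ Gr x) :
    ∑ x ∈ F, w x * X x * h x * φ x ^ s
      + 1 / 2 * ∑ x ∈ F, ∑ y ∈ F, φ x ^ s * (μ x y * |u y - u x| ^ (m - 1) * |h y - h x|)
    ≤ s * H * K ^ (m - 1) * ∑ x ∈ F, w x * (g x ^ (m - 1) * h x * φ x ^ (s - 1) * Gr x) := by
  have hs0 : s ≠ 0 := by linarith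
  set J : V → V → ℝ := fun x y => |u y - u x| ^ (m - 2) * (u y - u x) with hJ
  set E : V → V → ℝ := fun x y => |u y - u x| ^ (m - 1) * h y * (s * φ x ^ (s - 1) * max (φ x - φ y) 0) with hE
  have h1 : ∑ x ∈ F, w x * X x * h x * φ x ^ s ≤ ∑ x ∈ F, ∑ y ∈ F, - (μ x y * J x y * (φ x ^ s * h x)) := by
    refine Finset.sum_le_sum fun x hx => ?_
    by_cases h0 : φ x = 0
    · simp [h0, Real.zero_rpow hs0]
    have := mul_le_mul_of_nonneg_right (hsol x hx h0) (mul_nonneg (Real.rpow_nonneg (hφ x) s) (hh x))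
    rw [Finset.sum_mul] at this
    rw [Finset.sum_neg_distrib]
    have e : ∑ y ∈ F, μ x y * J x y * (φ x ^ s * h x) = ∑ y ∈ F, μ x y * |u y - u x| ^ (m - 2) * (u y - u x) * (φ x ^ s * h x) := by
      refine Finset.sum_congr rfl fun y _ => ?_
      simp only [hJ]; ring
    rw [e]; linarith
  have h2 : ∑ x ∈ F, ∑ y ∈ F, - (μ x y * J x y * (φ x ^ s * h x)) = ∑ x ∈ F, ∑ y ∈ F, (μ x y * J x y * (φ y ^ s * h y)) := by
    rw [Finset.sum_comm]
    refine Finset.sum_congr rfl fun x _ => Finset.sum_congr rfl fun y _ => ?_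
    simp only [hJ]
    rw [hsymm y x, abs_sub_comm (u x) (u y)]; ring
  have h3 : ∑ x ∈ F, w x * X x * h x * φ x ^ s ≤ 1 / 2 * ∑ x ∈ F, ∑ y ∈ F, μ x y * (J x y * (φ y ^ s * h y - φ x ^ s * h x)) := by
    have : ∑ x ∈ F, ∑ y ∈ F, μ x y * (J x y * (φ y ^ s * h y - φ x ^ s * h x)) =
      ∑ x ∈ F, ∑ y ∈ F, (μ x y * J x y * (φ y ^ s * h y)) + ∑ x ∈ F, ∑ y ∈ F, - (μ x y * J x y * (φ x ^ s * h x)) := by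
      simp only [← Finset.sum_add_distrib]
      refine Finset.sum_congr rfl fun x _ => Finset.sum_congr rfl fun y _ => ?_
      ring
    rw [this]; linarith
  have h4 : ∑ x ∈ F, ∑ y ∈ F, μ x y * (J x y * (φ y ^ s * h y - φ x ^ s * h x)) ≤
      ∑ x ∈ F, ∑ y ∈ F, (-(φ x ^ s * (μ x y * |u y - u x| ^ (m - 1) * |h y - h x|)) + μ x y * E x y + μ y x * E y x) := by
    refine Finset.sum_le_sum fun x _ => Finset.sum_le_sum fun y _ => ?_
    have := mul_le_mul_of_nonneg_left (pair_aux (D := u y - u x) hm hs.le (hφ x) (hφ y) (hh x) (hh y)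
      (fun h => hanti _ _ (by linarith)) (fun h => hanti _ _ (by linarith))) (hnonneg x y)
    refine this.trans (le_of_eq ?_)
    simp only [hE]
    rw [hsymm y x, abs_sub_comm (u x) (u y)]; ring
  have h5 : ∑ x ∈ F, ∑ y ∈ F, (-(φ x ^ s * (μ x y * |u y - u x| ^ (m - 1) * |h y - h x|)) + μ x y * E x y + μ y x * E y x) =
      - (∑ x ∈ F, ∑ y ∈ F, φ x ^ s * (μ x y * |u y - u x| ^ (m - 1) * |h y - h x|)) + 2 * ∑ x ∈ F, ∑ y ∈ F, μ x y * E x y := by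
    simp only [Finset.sum_add_distrib, Finset.sum_neg_distrib]
    rw [Finset.sum_comm (f := fun x y => μ y x * E y x)]
    ring
  have h6 : ∑ x ∈ F, ∑ y ∈ F, μ x y * E x y ≤ s * H * K ^ (m - 1) * ∑ x ∈ F, w x * (g x ^ (m - 1) * h x * φ x ^ (s - 1) * Gr x) := by
    rw [Finset.mul_sum]
    refine Finset.sum_le_sum fun x hx => ?_
    by_cases h0 : φ x = 0
    · simp [hE, h0, Real.zero_rpow (by linarith : s - 1 ≠ 0)]
    have hnn : 0 ≤ s * H * K ^ (m - 1) * (g x ^ (m - 1) * h x * φ x ^ (s - 1) * Gr x) := by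
      have := hφ x; have := hh x; have := hg x; have := hGr x
      positivity
    calc ∑ y ∈ F, μ x y * E x y ≤ ∑ y ∈ F, μ x y * (s * H * K ^ (m - 1) * (g x ^ (m - 1) * h x * φ x ^ (s - 1) * Gr x)) := by
          refine Finset.sum_le_sum fun y _ => ?_
          rcases (hnonneg x y).eq_or_lt with h00 | hpos
          · simp [← h00]
          refine mul_le_mul_of_nonneg_left ?_ hpos.le
          have i1 : |u y - u x| ^ (m - 1) ≤ (K * g x) ^ (m - 1) :=
            Real.rpow_le_rpow (abs_nonneg _) (hK' x y hpos) (by linarith)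
          rw [Real.mul_rpow hK (hg x)] at i1
          have i2 : max (φ x - φ y) 0 ≤ Gr x := max_le (hG' x y hpos) (hGr x)
          have i3 := hH' x y hpos
          have := hφ x; have := hh x; have := hg x; have := hGr x; have := hh y
          calc E x y ≤ (K ^ (m - 1) * g x ^ (m - 1)) * (H * h x) * (s * φ x ^ (s - 1) * Gr x) := by
                simp only [hE]; gcongr
            _ = _ := by ring
      _ = (∑ y ∈ F, μ x y) * (s * H * K ^ (m - 1) * (g x ^ (m - 1) * h x * φ x ^ (s - 1) * Gr x)) := by
          rw [Finset.sum_mul]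
      _ ≤ w x * (s * H * K ^ (m - 1) * (g x ^ (m - 1) * h x * φ x ^ (s - 1) * Gr x)) :=
          mul_le_mul_of_nonneg_right (hw x hx h0) hnn
      _ = _ := by ring
  linarith

section GraphFacts

lemma ball_finite (G : SimpleGraph V) (hconn : G.Connected)
    (hlf : ∀ x, (G.neighborSet x).Finite) (o : V) (n : ℕ) : {x | G.dist o x ≤ n}.Finite := by
  induction n with
  | zero =>
    refine (Set.finite_singleton o).subset fun x hx => ?_
    have h0 : G.dist o x = 0 := Nat.le_zero.mp hx
    exact ((hconn o x).dist_eq_zero_iff.mp h0).symm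
  | succ n ih =>
    refine (ih.union (ih.biUnion fun x _ => hlf x)).subset fun x hx => ?_
    by_cases h : G.dist o x ≤ n
    · exact Or.inl h
    · right
      have hx' : G.dist o x = n + 1 := by
        have : G.dist o x ≤ n + 1 := hx
        omega
      obtain ⟨y, hy, hd⟩ := exists_parent_aux G hconn o x (by omega)
      exact Set.mem_biUnion (x := y) (show G.dist o y ≤ n by omega) hy

lemma finsum_nbr (G : SimpleGraph V) (x : V) (F : Finset V) (k : V → ℝ)
    (hF : ∀ y, G.Adj x y → y ∈ F) (hk : ∀ y, k y ≠ 0 → G.Adj x y) :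
    ∑ᶠ y, k y = ∑ y ∈ F, k y :=
  finsum_eq_sum_of_support_subset _ fun y hy => hF y (hk y hy)

variable (G : SimpleGraph V) (μ : V → V → ℝ)
    (hsymm : ∀ x y, μ x y = μ y x)
    (hnonneg : ∀ x y, 0 ≤ μ x y)
    (hadj : ∀ x y, 0 < μ x y ↔ G.Adj x y)

lemma adj_of_ne (hnonneg : ∀ x y, 0 ≤ μ x y)
    (hadj : ∀ x y, 0 < μ x y ↔ G.Adj x y) {x y : V} (h : μ x y ≠ 0) : G.Adj x y :=
  (hadj x y).1 (lt_of_le_of_ne (hnonneg x y) h.symm)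

lemma vM_eq (hnonneg : ∀ x y, 0 ≤ μ x y)
    (hadj : ∀ x y, 0 < μ x y ↔ G.Adj x y) (x : V) (F : Finset V)
    (hF : ∀ y, G.Adj x y → y ∈ F) : vMeasure μ x = ∑ y ∈ F, μ x y :=
  finsum_nbr G x F _ hF fun _ h => adj_of_ne G μ hnonneg hadj h

lemma vM_pos (hnonneg : ∀ x y, 0 ≤ μ x y)
    (hadj : ∀ x y, 0 < μ x y ↔ G.Adj x y) (hinf : Infinite V) (hconn : G.Connected)
    (hlf : ∀ x, (G.neighborSet x).Finite) (x : V) : 0 < vMeasure μ x := by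
  rw [vM_eq G μ hnonneg hadj x (hlf x).toFinset (by simp)]
  obtain ⟨y, hy⟩ := hconn.preconnected.exists_adj_of_nontrivial x
  exact Finset.sum_pos' (fun _ _ => hnonneg _ _) ⟨y, by simpa using hy, (hadj x y).2 hy⟩

lemma p0_aux (p₀ : ℝ) (hp₀ : 1 < p₀)
    (hcond : ∀ x y, G.Adj x y → 1 / p₀ ≤ μ x y / vMeasure μ x)
    {x y : V} (hx : 0 < vMeasure μ x) (h : G.Adj x y) : vMeasure μ x ≤ p₀ * μ x y := by
  have := hcond x y h
  rw [div_le_div_iff₀ (by linarith) hx] at this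
  linarith

lemma lap_sum (hnonneg : ∀ x y, 0 ≤ μ x y)
    (hadj : ∀ x y, 0 < μ x y ↔ G.Adj x y) (m : ℝ) (u X : V → ℝ) (x : V) (F : Finset V)
    (hF : ∀ y, G.Adj x y → y ∈ F) (hx : 0 < vMeasure μ x)
    (hsol : lapM μ m u x + X x ≤ 0) :
    ∑ y ∈ F, μ x y * |u y - u x| ^ (m - 2) * (u y - u x) ≤ - (vMeasure μ x * X x) := by
  unfold lapM at hsol
  rw [finsum_nbr G x F _ hF] at hsol
  · have := mul_le_mul_of_nonneg_left hsol hx.le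
    rw [mul_add, mul_inv_cancel_left₀ hx.ne'] at this
    linarith
  · intro y hy
    refine adj_of_ne G μ hnonneg hadj ?_
    rintro h; simp [h] at hy

lemma harnack_aux (hnonneg : ∀ x y, 0 ≤ μ x y)
    (hadj : ∀ x y, 0 < μ x y ↔ G.Adj x y)
    (hlf : ∀ x, (G.neighborSet x).Finite) (p₀ : ℝ) (hp₀ : 1 < p₀)
    (m : ℝ) (hm : 1 < m) (u X : V → ℝ) (x y : V)
    (hu : ∀ x, 0 < u x) (hX : 0 ≤ X x) (hx : 0 < vMeasure μ x)
    (hp : vMeasure μ x ≤ p₀ * μ x y)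
    (hsol : lapM μ m u x + X x ≤ 0) (hxy : G.Adj x y) :
    u y ≤ (1 + p₀ ^ (1 / (m - 1))) * u x := by
  by_cases hle : u y ≤ u x
  · have : 0 ≤ p₀ ^ (1 / (m - 1)) := Real.rpow_nonneg (by linarith) _
    nlinarith [hu x]
  push Not at hle
  have hD : 0 < u y - u x := by linarith
  have key := lap_sum G μ hnonneg hadj m u X x (hlf x).toFinset (by simp) hx hsol
  have e : ∀ z, - (μ x z * u x ^ (m - 1)) ≤ μ x z * |u z - u x| ^ (m - 2) * (u z - u x) := by
    intro z
    rcases le_or_gt 0 (u z - u x) with h | h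
    · have := hnonneg x z
      have h1 : 0 ≤ μ x z * |u z - u x| ^ (m - 2) * (u z - u x) := by positivity
      have h2 : 0 ≤ μ x z * u x ^ (m - 1) := mul_nonneg this (Real.rpow_nonneg (hu x).le _)
      linarith
    · have h1 : |u z - u x| ^ (m - 2) * (u z - u x) = - |u z - u x| ^ (m - 1) := by
        have : |u z - u x| ^ (m - 1) = |u z - u x| ^ (m - 2) * |u z - u x| := by
          rw [← Real.rpow_add_one (abs_pos.mpr h.ne).ne']; ring_nf
        rw [this, abs_of_neg h]; ring
      rw [mul_assoc, h1]
      have h2 : |u z - u x| ^ (m - 1) ≤ u x ^ (m - 1) := by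
        refine Real.rpow_le_rpow (abs_nonneg _) ?_ (by linarith)
        rw [abs_of_neg h]; linarith [hu z]
      nlinarith [hnonneg x z]
  have hy : y ∈ (hlf x).toFinset := by simpa using hxy
  have h1 : μ x y * (u y - u x) ^ (m - 1) ≤ vMeasure μ x * u x ^ (m - 1) := by
    have hpw : (u y - u x) ^ (m - 1) = |u y - u x| ^ (m - 2) * (u y - u x) := by
      rw [abs_of_pos hD, ← Real.rpow_add_one hD.ne']; ring_nf
    rw [vM_eq G μ hnonneg hadj x (hlf x).toFinset (by simp), Finset.sum_mul]
    have h2 : μ x y * |u y - u x| ^ (m - 2) * (u y - u x) + μ x y * u x ^ (m - 1) ≤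
        ∑ z ∈ (hlf x).toFinset, (μ x z * |u z - u x| ^ (m - 2) * (u z - u x) + μ x z * u x ^ (m - 1)) :=
      Finset.single_le_sum (f := fun z => μ x z * |u z - u x| ^ (m - 2) * (u z - u x) + μ x z * u x ^ (m - 1))
        (fun z _ => by linarith [e z]) hy
    rw [Finset.sum_add_distrib] at h2
    have h3 : 0 ≤ μ x y * u x ^ (m - 1) := mul_nonneg (hnonneg x y) (Real.rpow_nonneg (hu x).le _)
    have h4 := mul_nonneg hx.le hX
    rw [hpw]; linarith
  have hμ : 0 < μ x y := (hadj x y).2 hxy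
  have hux : 0 ≤ u x ^ (m - 1) := Real.rpow_nonneg (hu x).le _
  have h2 : (u y - u x) ^ (m - 1) ≤ p₀ * u x ^ (m - 1) := by
    have : μ x y * (u y - u x) ^ (m - 1) ≤ μ x y * (p₀ * u x ^ (m - 1)) := by nlinarith
    exact le_of_mul_le_mul_left this hμ
  have h3 : u y - u x ≤ p₀ ^ (1 / (m - 1)) * u x := by
    have hm1 : 0 < m - 1 := by linarith
    have h4 := Real.rpow_le_rpow (by positivity) h2 (by positivity : 0 ≤ 1 / (m - 1))
    rw [Real.mul_rpow (by linarith) hux, ← Real.rpow_mul hD.le, ← Real.rpow_mul (hu x).le,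
      mul_one_div_cancel hm1.ne', Real.rpow_one, Real.rpow_one] at h4
    exact h4
  linarith

lemma grad_sq (hnonneg : ∀ x y, 0 ≤ μ x y)
    (hadj : ∀ x y, 0 < μ x y ↔ G.Adj x y)
    (hlf : ∀ x, (G.neighborSet x).Finite) (u : V → ℝ) (x : V) (hx : 0 < vMeasure μ x) :
    gradNorm μ u x ^ 2 = ∑ y ∈ (hlf x).toFinset, μ x y / (2 * vMeasure μ x) * (u y - u x) ^ 2 := by
  unfold gradNorm
  rw [finsum_nbr G x (hlf x).toFinset _ (by simp), Real.sq_sqrt]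
  · exact Finset.sum_nonneg fun y _ => by have := hnonneg x y; positivity
  · intro y hy
    refine adj_of_ne G μ hnonneg hadj ?_
    rintro h; simp [h] at hy

lemma grad_upper (hnonneg : ∀ x y, 0 ≤ μ x y)
    (hadj : ∀ x y, 0 < μ x y ↔ G.Adj x y)
    (hlf : ∀ x, (G.neighborSet x).Finite) (u : V → ℝ) (x y : V) (hx : 0 < vMeasure μ x)
    (p₀ : ℝ) (hp₀ : 1 < p₀) (hp : vMeasure μ x ≤ p₀ * μ x y) (hxy : G.Adj x y) :
    |u y - u x| ≤ Real.sqrt (2 * p₀) * gradNorm μ u x := by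
  have h := grad_sq G μ hnonneg hadj hlf u x hx
  have h1 : μ x y / (2 * vMeasure μ x) * (u y - u x) ^ 2 ≤ gradNorm μ u x ^ 2 := by
    rw [h]
    exact Finset.single_le_sum (f := fun y => μ x y / (2 * vMeasure μ x) * (u y - u x) ^ 2)
      (fun y _ => by have := hnonneg x y; positivity) (by simpa using hxy)
  have h0 : 0 ≤ gradNorm μ u x := Real.sqrt_nonneg _
  refine abs_le_of_sq_le_sq ?_ (by positivity)
  rw [mul_pow, Real.sq_sqrt (by linarith)]
  have h2 : 1 / (2 * p₀) ≤ μ x y / (2 * vMeasure μ x) := by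
    rw [div_le_div_iff₀ (by linarith) (by linarith)]; linarith
  have h3 : 1 / (2 * p₀) * (u y - u x) ^ 2 ≤ gradNorm μ u x ^ 2 :=
    (mul_le_mul_of_nonneg_right h2 (sq_nonneg _)).trans h1
  have h4 := mul_le_mul_of_nonneg_left h3 (by linarith : 0 ≤ 2 * p₀)
  rwa [← mul_assoc, mul_one_div_cancel (by linarith), one_mul] at h4

lemma grad_lower (hnonneg : ∀ x y, 0 ≤ μ x y)
    (hadj : ∀ x y, 0 < μ x y ↔ G.Adj x y)
    (hlf : ∀ x, (G.neighborSet x).Finite) (u : V → ℝ) (x : V) (hx : 0 < vMeasure μ x)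
    (hg : 0 < gradNorm μ u x) :
    ∃ y, G.Adj x y ∧ gradNorm μ u x ≤ |u y - u x| := by
  by_contra hcon
  push Not at hcon
  have h := grad_sq G μ hnonneg hadj hlf u x hx
  have h1 : ∑ y ∈ (hlf x).toFinset, μ x y / (2 * vMeasure μ x) * (u y - u x) ^ 2
      ≤ ∑ y ∈ (hlf x).toFinset, μ x y / (2 * vMeasure μ x) * gradNorm μ u x ^ 2 := by
    refine Finset.sum_le_sum fun y hy => ?_
    have := hnonneg x y
    refine mul_le_mul_of_nonneg_left ?_ (by positivity)
    rw [← sq_abs (u y - u x)]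
    exact pow_le_pow_left₀ (abs_nonneg _) (hcon y (by simpa using hy)).le 2
  rw [← Finset.sum_mul, ← Finset.sum_div, ← vM_eq G μ hnonneg hadj x (hlf x).toFinset (by simp), ← h] at h1
  have h2 : vMeasure μ x / (2 * vMeasure μ x) = 1 / 2 := by field_simp
  rw [h2] at h1
  nlinarith [pow_pos hg 2]

open Classical in
lemma vol_le_W (hsymm : ∀ x y, μ x y = μ y x) (hnonneg : ∀ x y, 0 ≤ μ x y)
    (hadj : ∀ x y, 0 < μ x y ↔ G.Adj x y) (hconn : G.Connected)
    (hlf : ∀ x, (G.neighborSet x).Finite) (p₀ : ℝ) (hp₀ : 1 < p₀)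
    (hp : ∀ x y, G.Adj x y → vMeasure μ x ≤ p₀ * μ x y) (o : V) (n : ℕ) (S : Finset V)
    (hS : ∀ x ∈ S, 0 < G.dist o x ∧ G.dist o x ≤ n) :
    ∑ x ∈ S, vMeasure μ x ≤ p₀ * Wvol G μ o n := by
  set F : Finset V := (ball_finite G hconn hlf o (n+1)).toFinset with hF
  have hmem : ∀ x, x ∈ F ↔ G.dist o x ≤ n + 1 := by simp [hF]
  have hW : Wvol G μ o n = ∑ x ∈ F, ∑ y ∈ F, if G.dist o x ≤ n ∧ G.dist o x < G.dist o y then μ x y else 0 := by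
    unfold Wvol
    have e : ∀ x, (∑ᶠ y, if G.dist o x ≤ n ∧ G.dist o x < G.dist o y then μ x y else 0) =
        ∑ y ∈ F, if G.dist o x ≤ n ∧ G.dist o x < G.dist o y then μ x y else 0 := by
      intro x
      refine finsum_eq_sum_of_support_subset _ fun y hy => ?_
      simp only [Function.mem_support, ne_eq, ite_eq_right_iff, Classical.not_imp] at hy
      have ha := adj_of_ne G μ hnonneg hadj hy.2
      have := hconn.dist_triangle (u := o) (v := x) (w := y)
      rw [SimpleGraph.dist_eq_one_iff_adj.mpr ha] at this
      exact (hmem y).2 (by omega)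
    rw [finsum_congr e]
    refine finsum_eq_sum_of_support_subset _ fun x hx => ?_
    by_contra hx'
    apply hx
    refine Finset.sum_eq_zero fun y _ => ?_
    rw [if_neg]
    rintro ⟨h1, -⟩
    exact hx' ((hmem x).2 (by omega))
  rw [hW, Finset.sum_comm, Finset.mul_sum]
  have hnn : ∀ y z, 0 ≤ (if G.dist o y ≤ n ∧ G.dist o y < G.dist o z then μ y z else 0) := by
    intro y z; split_ifs; exacts [hnonneg _ _, le_rfl]
  calc ∑ x ∈ S, vMeasure μ x ≤ ∑ x ∈ S, p₀ * ∑ y ∈ F, (if G.dist o y ≤ n ∧ G.dist o y < G.dist o x then μ y x else 0) := by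
        refine Finset.sum_le_sum fun x hx => ?_
        obtain ⟨h0, h1⟩ := hS x hx
        obtain ⟨y, hy, hd⟩ := exists_parent_aux G hconn o x h0
        refine (hp x y hy.symm).trans (mul_le_mul_of_nonneg_left ?_ (by linarith))
        have := Finset.single_le_sum (f := fun y => (if G.dist o y ≤ n ∧ G.dist o y < G.dist o x then μ y x else 0))
          (fun y _ => hnn y x) ((hmem y).2 (by omega))
        rw [if_pos (by omega)] at this
        rw [hsymm x y]; exact this
    _ ≤ _ := by
        refine Finset.sum_le_sum_of_subset_of_nonneg (fun x hx => (hmem x).2 (by have := hS x hx; omega)) fun x _ _ => ?_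
        exact mul_nonneg (by linarith) (Finset.sum_nonneg fun y _ => hnn y x)

end GraphFacts

noncomputable def cutφ (j r : ℕ) : ℝ := max 0 (min 1 (2 - Real.logb 2 r / j))

noncomputable def cutG (j r : ℕ) : ℝ := if 2 ^ j ≤ r ∧ r < 2 ^ (2 * j) then 2 / (j * r) else 0

lemma cutφ_nonneg (j r : ℕ) : 0 ≤ cutφ j r := le_max_left _ _

lemma cutφ_le_one (j r : ℕ) : cutφ j r ≤ 1 := max_le zero_le_one (min_le_left _ _)

lemma cutG_nonneg (j r : ℕ) : 0 ≤ cutG j r := by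
  unfold cutG; split_ifs <;> positivity

lemma cutφ_one {j r : ℕ} (hj : 0 < j) (h : r ≤ 2 ^ j) : cutφ j r = 1 := by
  have hj' : (0 : ℝ) < j := by exact_mod_cast hj
  have : Real.logb 2 r ≤ j := by
    rcases Nat.eq_zero_or_pos r with h0 | h0
    · simp [h0]
    · rw [Real.logb_le_iff_le_rpow (by norm_num) (by exact_mod_cast h0), Real.rpow_natCast]
      exact_mod_cast h
  have h2 : Real.logb 2 r / j ≤ 1 := by rw [div_le_one hj']; exact this
  unfold cutφ
  rw [min_eq_left (by linarith), max_eq_right (by norm_num)]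

lemma cutφ_zero {j r : ℕ} (hj : 0 < j) (h : 2 ^ (2 * j) ≤ r) : cutφ j r = 0 := by
  have hj' : (0 : ℝ) < j := by exact_mod_cast hj
  have h0 : 0 < r := lt_of_lt_of_le (by positivity) h
  have : 2 * (j : ℝ) ≤ Real.logb 2 r := by
    rw [Real.le_logb_iff_rpow_le (by norm_num) (by exact_mod_cast h0)]
    have e : (2 * (j : ℝ)) = ((2 * j : ℕ) : ℝ) := by push_cast; ring
    rw [e, Real.rpow_natCast]
    exact_mod_cast h
  have h2 : 2 ≤ Real.logb 2 r / j := by rw [le_div_iff₀ hj']; exact this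
  unfold cutφ
  exact max_eq_left ((min_le_right _ _).trans (by linarith))

lemma cutφ_anti {j r r' : ℕ} (hj : 0 < j) (h : r ≤ r') : cutφ j r' ≤ cutφ j r := by
  rcases Nat.eq_zero_or_pos r with h0 | h0
  · rw [cutφ_one (r := r) hj (by simp [h0])]; exact cutφ_le_one _ _
  have h1 : Real.logb 2 r ≤ Real.logb 2 r' :=
    Real.logb_le_logb_of_le (by norm_num) (by exact_mod_cast h0) (by exact_mod_cast h)
  unfold cutφ
  gcongr

lemma cutφ_diff {j r r' : ℕ} (hj : 0 < j) (h : r' ≤ r + 1) : cutφ j r - cutφ j r' ≤ cutG j r := by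
  have h1 := cutφ_anti hj h
  suffices H : cutφ j r - cutφ j (r + 1) ≤ cutG j r by linarith
  have hj' : (0 : ℝ) < j := by exact_mod_cast hj
  by_cases hr : 2 ^ j ≤ r
  · by_cases hr2 : r < 2 ^ (2 * j)
    · have h0 : 0 < r := lt_of_lt_of_le (by positivity) hr
      have h0' : (0 : ℝ) < r := by exact_mod_cast h0
      unfold cutG
      rw [if_pos ⟨hr, hr2⟩]
      have key : Real.logb 2 ((r + 1 : ℕ) : ℝ) - Real.logb 2 r ≤ 2 / r := by
        rw [← Real.logb_div (by positivity) (by positivity), Real.logb, div_le_iff₀ (Real.log_pos (by norm_num))]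
        have e : ((r + 1 : ℕ) : ℝ) / r = 1 + 1 / r := by push_cast; field_simp
        rw [e]
        have := Real.log_le_sub_one_of_pos (x := 1 + 1 / (r : ℝ)) (by positivity)
        have l2 := Real.log_two_gt_d9
        have : 1 / (r : ℝ) ≤ 2 / r * Real.log 2 := by
          have : (2 / r * Real.log 2 : ℝ) = (2 * Real.log 2) * (1 / r) := by ring
          rw [this]
          have : (0:ℝ) < 1 / r := by positivity
          nlinarith
        linarith
      have key2 : (2 - Real.logb 2 r / j) - (2 - Real.logb 2 ((r + 1 : ℕ) : ℝ) / j) ≤ 2 / (j * r) := by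
        have := div_le_div_of_nonneg_right key hj'.le
        rw [div_div, mul_comm (r : ℝ), sub_div] at this
        linarith
      have hnn : (0 : ℝ) ≤ 2 / (j * r) := by positivity
      unfold cutφ
      generalize 2 - Real.logb 2 r / j = a at *
      generalize 2 - Real.logb 2 ((r + 1 : ℕ) : ℝ) / j = b at *
      generalize 2 / ((j : ℝ) * r) = c at *
      rcases max_cases 0 (min 1 a) with h | h <;> rcases max_cases 0 (min 1 b) with h' | h' <;>
      rcases min_cases 1 a with k | k <;> rcases min_cases 1 b with k' | k' <;> linarith
    · rw [cutφ_zero hj (not_lt.mp hr2)]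
      have := cutφ_nonneg j (r+1)
      have := cutG_nonneg j r
      linarith
  · rw [cutφ_one (r := r + 1) hj (by omega)]
    have := cutφ_le_one j r
    have := cutG_nonneg j r
    linarith

lemma annulus_sum (w : V → ℝ) (r : V → ℕ) (hw : ∀ x, 0 ≤ w x) (C κ L : ℝ) (hC : 0 < C) (hκ : 0 < κ)
    (hL : 0 < L) (N : ℕ)
    (hvol : ∀ n : ℕ, N ≤ n → ∀ S : Finset V, (∀ x ∈ S, 0 < r x ∧ r x ≤ n) →
      ∑ x ∈ S, w x ≤ C * (n : ℝ) ^ κ * (Real.log n) ^ L)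
    (j : ℕ) (hj : 0 < j) (hN : N ≤ j) (S : Finset V) (hS : ∀ x ∈ S, 2 ^ j ≤ r x ∧ r x < 2 ^ (2 * j)) :
    ∑ x ∈ S, w x * (r x : ℝ) ^ (-κ) ≤ C * 2 ^ κ * 2 ^ L * (j : ℝ) ^ (1 + L) := by
  have hj' : (0 : ℝ) < j := by exact_mod_cast hj
  have hr0 : ∀ x ∈ S, 0 < r x := fun x hx => lt_of_lt_of_le (by positivity) (hS x hx).1
  have hmap : ∀ x ∈ S, Nat.log 2 (r x) ∈ Finset.Ico j (2 * j) := by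
    intro x hx
    rw [Finset.mem_Ico]
    exact ⟨Nat.le_log_of_pow_le (by norm_num) (hS x hx).1, Nat.log_lt_of_lt_pow (hr0 x hx).ne' (hS x hx).2⟩
  rw [← Finset.sum_fiberwise_of_maps_to hmap]
  have hone : ∀ i ∈ Finset.Ico j (2 * j), ∑ x ∈ S with Nat.log 2 (r x) = i, w x * (r x : ℝ) ^ (-κ) ≤
      C * 2 ^ κ * 2 ^ L * (j : ℝ) ^ L := by
    intro i hi
    rw [Finset.mem_Ico] at hi
    have hlt : j < 2 ^ j := Nat.lt_two_pow_self
    have hle : 2 ^ j ≤ 2 ^ (i + 1) := Nat.pow_le_pow_right (by norm_num) (by omega)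
    have hv := hvol (2 ^ (i + 1)) (by omega) (S.filter fun x => Nat.log 2 (r x) = i) (by
      intro x hx
      rw [Finset.mem_filter] at hx
      refine ⟨hr0 x hx.1, ?_⟩
      have := Nat.lt_pow_succ_log_self (b := 2) (by norm_num) (r x)
      rw [hx.2] at this; exact this.le)
    have h1 : ∑ x ∈ S with Nat.log 2 (r x) = i, w x * (r x : ℝ) ^ (-κ) ≤
        (∑ x ∈ S with Nat.log 2 (r x) = i, w x) * ((2 : ℝ) ^ i) ^ (-κ) := by
      rw [Finset.sum_mul]
      refine Finset.sum_le_sum fun x hx => mul_le_mul_of_nonneg_left ?_ (hw x)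
      rw [Finset.mem_filter] at hx
      refine Real.rpow_le_rpow_of_nonpos (by positivity) ?_ (by linarith)
      have := Nat.pow_log_le_self 2 (hr0 x hx.1).ne'
      rw [hx.2] at this
      exact_mod_cast this
    refine h1.trans ((mul_le_mul_of_nonneg_right hv (by positivity)).trans ?_)
    push_cast
    have e1 : ((2 : ℝ) ^ (i + 1)) ^ κ * ((2 : ℝ) ^ i) ^ (-κ) = 2 ^ κ := by
      rw [pow_succ, Real.mul_rpow (by positivity) (by positivity), Real.rpow_neg (by positivity)]
      field_simp
    have e2 : Real.log ((2 : ℝ) ^ (i + 1)) ^ L ≤ 2 ^ L * (j : ℝ) ^ L := by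
      rw [← Real.mul_rpow (by norm_num) hj'.le, Real.log_pow]
      have l1 := Real.log_two_lt_d9
      have l2 := Real.log_two_gt_d9
      refine Real.rpow_le_rpow (by positivity) ?_ hL.le
      have : ((i + 1 : ℕ) : ℝ) ≤ 2 * j := by exact_mod_cast (by omega)
      nlinarith
    calc C * ((2 : ℝ) ^ (i + 1)) ^ κ * Real.log ((2 : ℝ) ^ (i + 1)) ^ L * ((2 : ℝ) ^ i) ^ (-κ)
        = C * (((2 : ℝ) ^ (i + 1)) ^ κ * ((2 : ℝ) ^ i) ^ (-κ)) * Real.log ((2 : ℝ) ^ (i + 1)) ^ L := by ring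
      _ ≤ C * 2 ^ κ * (2 ^ L * (j : ℝ) ^ L) := by rw [e1]; gcongr
      _ = _ := by ring
  refine (Finset.sum_le_sum hone).trans (le_of_eq ?_)
  rw [Finset.sum_const, Nat.card_Ico, nsmul_eq_mul, Real.rpow_add hj', Real.rpow_one]
  have : 2 * j - j = j := by omega
  rw [this]; ring

lemma annulus_Z (w : V → ℝ) (r : V → ℕ) (hw : ∀ x, 0 ≤ w x) (C κ L : ℝ) (hC : 0 < C) (hκ : 0 < κ)
    (hL : 0 < L) (N : ℕ)
    (hvol : ∀ n : ℕ, N ≤ n → ∀ S : Finset V, (∀ x ∈ S, 0 < r x ∧ r x ≤ n) →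
      ∑ x ∈ S, w x ≤ C * (n : ℝ) ^ κ * (Real.log n) ^ L)
    (θ : ℝ) (hθ : 0 ≤ θ)
    (j : ℕ) (hj : 0 < j) (hN : N ≤ j) (F : Finset V) (hpos : 0 < κ - 1 / j * θ) :
    ∑ x ∈ F, w x * cutG j (r x) ^ (κ - 1 / j * θ) ≤
      2 ^ κ * 2 ^ (2 * θ) * (C * 2 ^ κ * 2 ^ L) * (1 / (j : ℝ)) ^ (κ - 1 / j * θ - 1 - L) := by
  classical
  have hj' : (0 : ℝ) < j := by exact_mod_cast hj
  set S := F.filter fun x => 2 ^ j ≤ r x ∧ r x < 2 ^ (2 * j) with hSdef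
  have hS : ∀ x ∈ S, 2 ^ j ≤ r x ∧ r x < 2 ^ (2 * j) := fun x hx => (Finset.mem_filter.1 hx).2
  have hA := annulus_sum w r hw C κ L hC hκ hL N hvol j hj hN S hS
  set κ' := κ - 1 / j * θ with hκ'
  have h1 : ∑ x ∈ F, w x * cutG j (r x) ^ κ' = ∑ x ∈ S, w x * cutG j (r x) ^ κ' := by
    symm
    refine Finset.sum_subset (Finset.filter_subset _ _) fun x hx hx' => ?_
    have : ¬ (2 ^ j ≤ r x ∧ r x < 2 ^ (2 * j)) := fun h => hx' (Finset.mem_filter.2 ⟨hx, h⟩)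
    simp [cutG, this, Real.zero_rpow hpos.ne']
  have h2 : ∀ x ∈ S, cutG j (r x) ^ κ' ≤ 2 ^ κ * 2 ^ (2 * θ) * (1 / (j : ℝ)) ^ κ' * (r x : ℝ) ^ (-κ) := by
    intro x hx
    have hr : (0 : ℝ) < r x := by
      have : 0 < r x := lt_of_lt_of_le (by positivity) (hS x hx).1
      exact_mod_cast this
    have e : cutG j (r x) = 2 * (1 / (j : ℝ)) * (r x : ℝ)⁻¹ := by
      unfold cutG; rw [if_pos (hS x hx)]; field_simp
    rw [e, Real.mul_rpow (by positivity) (by positivity), Real.mul_rpow (by positivity) (by positivity)]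
    have a1 : (2 : ℝ) ^ κ' ≤ 2 ^ κ := by
      refine Real.rpow_le_rpow_of_exponent_le (by norm_num) ?_
      have : 0 ≤ 1 / (j : ℝ) * θ := by positivity
      linarith
    have a2 : ((r x : ℝ)⁻¹) ^ κ' ≤ 2 ^ (2 * θ) * (r x : ℝ) ^ (-κ) := by
      rw [Real.inv_rpow hr.le, ← Real.rpow_neg hr.le]
      have : -κ' = 1 / j * θ + (-κ) := by rw [hκ']; ring
      rw [this, Real.rpow_add hr]
      refine mul_le_mul_of_nonneg_right ?_ (by positivity)
      have b1 : (r x : ℝ) ≤ (2 : ℝ) ^ (2 * j : ℕ) := by exact_mod_cast (hS x hx).2.le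
      refine (Real.rpow_le_rpow hr.le b1 (by positivity)).trans (le_of_eq ?_)
      rw [← Real.rpow_natCast, ← Real.rpow_mul (by norm_num)]
      congr 1; push_cast; field_simp
    calc (2 : ℝ) ^ κ' * (1 / (j : ℝ)) ^ κ' * ((r x : ℝ)⁻¹) ^ κ' ≤ 2 ^ κ * (1 / (j : ℝ)) ^ κ' * (2 ^ (2 * θ) * (r x : ℝ) ^ (-κ)) := by
          gcongr
      _ = _ := by ring
  rw [h1]
  calc ∑ x ∈ S, w x * cutG j (r x) ^ κ' ≤ ∑ x ∈ S, (2 ^ κ * 2 ^ (2 * θ) * (1 / (j : ℝ)) ^ κ') * (w x * (r x : ℝ) ^ (-κ)) := by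
        refine Finset.sum_le_sum fun x hx => ?_
        refine (mul_le_mul_of_nonneg_left (h2 x hx) (hw x)).trans (le_of_eq (by ring))
    _ = (2 ^ κ * 2 ^ (2 * θ) * (1 / (j : ℝ)) ^ κ') * ∑ x ∈ S, (w x * (r x : ℝ) ^ (-κ)) := by rw [Finset.mul_sum]
    _ ≤ (2 ^ κ * 2 ^ (2 * θ) * (1 / (j : ℝ)) ^ κ') * (C * 2 ^ κ * 2 ^ L * (j : ℝ) ^ (1 + L)) := by gcongr
    _ = _ := by
        have : (1 / (j : ℝ)) ^ (κ' - 1 - L) = (1 / (j : ℝ)) ^ κ' * (j : ℝ) ^ (1 + L) := by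
          rw [show κ' - 1 - L = κ' + (-(1 + L)) by ring, Real.rpow_add (by positivity)]
          congr 1
          rw [one_div, Real.inv_rpow hj'.le, Real.rpow_neg hj'.le, inv_inv]
        rw [this]; ring

lemma young_pt {a b c l1 l2 l3 E X Y φ Γ s : ℝ} (ha : 0 ≤ a) (hb : 0 ≤ b) (hc : 0 < c)
    (habc : a + b + c = 1) (h1 : 0 < l1) (h2 : 0 < l2) (h3 : 0 < l3)
    (hl : l1 ^ a * l2 ^ b * l3 ^ c = 1) (hX : 0 ≤ X) (hY : 0 ≤ Y) (hφ : 0 ≤ φ) (hφ1 : φ ≤ 1)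
    (hΓ : 0 ≤ Γ) (hs : 1 < s) (hcs : 1 / c ≤ s) (hE : E ≤ X ^ a * Y ^ b) :
    E * φ ^ (s - 1) * Γ ≤ l1 * (X * φ ^ s) + l2 * (Y * φ ^ s) + l3 * Γ ^ (1 / c) := by
  rcases hφ.eq_or_lt with h0 | h0
  · rw [← h0, Real.zero_rpow (by linarith), Real.zero_rpow (by linarith)]
    have : 0 ≤ l3 * Γ ^ (1 / c) := by positivity
    simpa using this
  have key := Real.geom_mean_le_arith_mean3_weighted ha hb hc.le
    (show 0 ≤ l1 * (X * φ ^ s) by positivity) (show 0 ≤ l2 * (Y * φ ^ s) by positivity)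
    (show 0 ≤ l3 * (Γ ^ (1 / c) * φ ^ (s - 1 / c)) by positivity) habc
  have e : (l1 * (X * φ ^ s)) ^ a * (l2 * (Y * φ ^ s)) ^ b * (l3 * (Γ ^ (1 / c) * φ ^ (s - 1 / c))) ^ c
      = X ^ a * Y ^ b * φ ^ (s - 1) * Γ := by
    rw [Real.mul_rpow h1.le (by positivity), Real.mul_rpow h2.le (by positivity),
      Real.mul_rpow h3.le (by positivity), Real.mul_rpow hX (by positivity),
      Real.mul_rpow hY (by positivity), Real.mul_rpow (by positivity) (by positivity),
      ← Real.rpow_mul hφ, ← Real.rpow_mul hφ, ← Real.rpow_mul hφ, ← Real.rpow_mul hΓ,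
      one_div_mul_cancel hc.ne', Real.rpow_one]
    have e1 : φ ^ (s - 1) = φ ^ (s * a) * φ ^ (s * b) * φ ^ ((s - 1 / c) * c) := by
      rw [← Real.rpow_add h0, ← Real.rpow_add h0]
      congr 1
      have : 1 / c * c = 1 := one_div_mul_cancel hc.ne'
      linear_combination - s * habc + this
    rw [e1]
    linear_combination (X ^ a * Y ^ b * Γ * φ ^ (s * a) * φ ^ (s * b) * φ ^ ((s - 1 / c) * c)) * hl
  rw [e] at key
  have b1 : E * φ ^ (s - 1) * Γ ≤ X ^ a * Y ^ b * φ ^ (s - 1) * Γ := by gcongr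
  have b2 : φ ^ (s - 1 / c) ≤ 1 := Real.rpow_le_one hφ hφ1 (by linarith)
  have n1 : 0 ≤ l1 * (X * φ ^ s) := by positivity
  have n2 : 0 ≤ l2 * (Y * φ ^ s) := by positivity
  have n3 : 0 ≤ l3 * Γ ^ (1 / c) := by positivity
  have b3 : l3 * (Γ ^ (1 / c) * φ ^ (s - 1 / c)) ≤ l3 * Γ ^ (1 / c) := by
    rw [← mul_assoc]; exact mul_le_of_le_one_right n3 b2
  have n4 : 0 ≤ l3 * (Γ ^ (1 / c) * φ ^ (s - 1 / c)) := by positivity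
  have c1 : a * (l1 * (X * φ ^ s)) ≤ l1 * (X * φ ^ s) := mul_le_of_le_one_left n1 (by linarith)
  have c2 : b * (l2 * (Y * φ ^ s)) ≤ l2 * (Y * φ ^ s) := mul_le_of_le_one_left n2 (by linarith)
  have c3 : c * (l3 * (Γ ^ (1 / c) * φ ^ (s - 1 / c))) ≤ l3 * (Γ ^ (1 / c) * φ ^ (s - 1 / c)) :=
    mul_le_of_le_one_left n4 (by linarith)
  linarith

lemma negpow_aux {a b t : ℝ} (ha : 0 < a) (hab : a ≤ b) (ht : 0 < t) :
    t * (b - a) * b ^ (-t - 1) ≤ a ^ (-t) - b ^ (-t) := by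
  have hb : 0 < b := ha.trans_le hab
  have h1 : 1 + t * (1 - a / b) ≤ (a / b) ^ (-t) := by
    rw [Real.rpow_def_of_pos (by positivity)]
    have l1 := Real.log_le_sub_one_of_pos (x := a / b) (by positivity)
    have l2 := Real.add_one_le_exp (Real.log (a / b) * -t)
    nlinarith
  rw [Real.div_rpow ha.le hb.le, le_div_iff₀ (by positivity)] at h1
  have e : b ^ (-t) = b ^ (-t - 1) * b := by
    rw [← Real.rpow_add_one hb.ne']; ring_nf
  have e2 : (1 + t * (1 - a / b)) * b ^ (-t) = b ^ (-t) + t * (b - a) * b ^ (-t - 1) := by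
    rw [e]; field_simp
  linarith

lemma negpow_lower {v w t H : ℝ} (hv : 0 < v) (hw : 0 < w) (ht : 0 < t) (ht1 : t ≤ 1) (hH : 1 ≤ H)
    (hwv : w ≤ H * v) :
    t * |w - v| * ((H ^ 2)⁻¹ * v ^ (-1 - t)) ≤ |w ^ (-t) - v ^ (-t)| := by
  have hb : ∀ b, 0 < b → b ≤ H * v → (H ^ 2)⁻¹ * v ^ (-1 - t) ≤ b ^ (-t - 1) := by
    intro b hb hbv
    have h1 : (H * v) ^ (-t - 1) ≤ b ^ (-t - 1) := Real.rpow_le_rpow_of_nonpos hb hbv (by linarith)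
    rw [Real.mul_rpow (by linarith) hv.le] at h1
    have h2 : (H ^ 2)⁻¹ ≤ H ^ (-t - 1) := by
      have : (H ^ 2)⁻¹ = H ^ (-2 : ℝ) := by
        rw [Real.rpow_neg (by linarith)]; norm_num
      rw [this]
      exact Real.rpow_le_rpow_of_exponent_le hH (by linarith)
    have h3 : (-1 - t) = -t - 1 := by ring
    rw [h3]
    exact (mul_le_mul_of_nonneg_right h2 (by positivity)).trans h1
  rcases le_total v w with h | h
  · have k := negpow_aux hv h ht
    rw [abs_of_nonneg (by linarith), abs_sub_comm]
    refine le_trans ?_ (k.trans (le_abs_self _))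
    exact mul_le_mul_of_nonneg_left (hb w hw hwv) (mul_nonneg ht.le (by linarith))
  · have k := negpow_aux hw h ht
    rw [abs_sub_comm, abs_of_nonneg (by linarith)]
    refine le_trans ?_ (k.trans (le_abs_self _))
    exact mul_le_mul_of_nonneg_left (hb v hv (by nlinarith)) (mul_nonneg ht.le (by linarith))

lemma pow_split {u g p q m t z a b : ℝ} (hu : 0 < u) (hg : 0 < g) :
    (u ^ p * g ^ q * u ^ z) ^ a * (g ^ m * u ^ (-1 - t)) ^ b =
      u ^ ((p + z) * a + (-1 - t) * b) * g ^ (q * a + m * b) := by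
  rw [Real.mul_rpow (by positivity) (by positivity), Real.mul_rpow (by positivity) (by positivity),
    Real.mul_rpow (by positivity) (by positivity), ← Real.rpow_mul hu.le, ← Real.rpow_mul hg.le,
    ← Real.rpow_mul hu.le, ← Real.rpow_mul hg.le, ← Real.rpow_mul hu.le,
    Real.rpow_add hu, Real.rpow_add hg, add_mul, Real.rpow_add hu]
  ring

structure CoreHyp (μ : V → V → ℝ) (w g u X : V → ℝ) (r : V → ℕ) (m p q H K p₀ C κ L : ℝ)
    (N : ℕ) : Prop where
  symm : ∀ x y, μ x y = μ y x
  nonneg : ∀ x y, 0 ≤ μ x y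
  ball : ∀ n : ℕ, {x | r x ≤ n}.Finite
  edge : ∀ x y, 0 < μ x y → r y ≤ r x + 1
  wpos : ∀ x, 0 < w x
  wsum : ∀ x (F : Finset V), (∀ y, 0 < μ x y → y ∈ F) → ∑ y ∈ F, μ x y = w x
  lap : ∀ x (F : Finset V), (∀ y, 0 < μ x y → y ∈ F) →
    ∑ y ∈ F, μ x y * |u y - u x| ^ (m - 2) * (u y - u x) ≤ - (w x * X x)
  Xdef : ∀ x, X x = u x ^ p * g x ^ q
  upos : ∀ x, 0 < u x
  gnn : ∀ x, 0 ≤ g x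
  hm : 1 < m
  hH : 1 ≤ H
  hK : 0 < K
  hp0 : 1 < p₀
  har : ∀ x y, 0 < μ x y → u y ≤ H * u x
  gup : ∀ x y, 0 < μ x y → |u y - u x| ≤ K * g x
  glow : ∀ x, 0 < g x → ∃ y, 0 < μ x y ∧ g x ≤ |u y - u x|
  hp : ∀ x y, 0 < μ x y → w x ≤ p₀ * μ x y
  hC : 0 < C
  hp' : 0 ≤ p
  hS : 0 < p + q - m + 1
  hq : q < m
  hκ : κ = (m * p + q) / (p + q - m + 1)
  hL : L = (m - 1) / (p + q - m + 1)
  vol : ∀ n : ℕ, N ≤ n → ∀ S : Finset V, (∀ x ∈ S, 0 < r x ∧ r x ≤ n) →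
      ∑ x ∈ S, w x ≤ C * (n : ℝ) ^ κ * (Real.log n) ^ L

section Core
variable {μ : V → V → ℝ} {w g u X : V → ℝ} {r : V → ℕ} {m p q H K p₀ C κ L : ℝ} {N : ℕ}

lemma CoreHyp.Xnn (c : CoreHyp μ w g u X r m p q H K p₀ C κ L N) (x : V) : 0 ≤ X x := by
  rw [c.Xdef]
  exact mul_nonneg (Real.rpow_nonneg (c.upos x).le _) (Real.rpow_nonneg (c.gnn x) _)

lemma CoreHyp.κ1 (c : CoreHyp μ w g u X r m p q H K p₀ C κ L N) : 1 < κ := by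
  rw [c.hκ, one_lt_div c.hS]
  nlinarith [c.hm, c.hp']

lemma CoreHyp.L0 (c : CoreHyp μ w g u X r m p q H K p₀ C κ L N) : 0 < L := by
  rw [c.hL]; exact div_pos (by linarith [c.hm]) c.hS

/-- The ball used for level `j`. -/
noncomputable def CoreHyp.F (c : CoreHyp μ w g u X r m p q H K p₀ C κ L N) (j : ℕ) : Finset V :=
  (c.ball (2 ^ (2 * j) + 1)).toFinset

lemma CoreHyp.memF (c : CoreHyp μ w g u X r m p q H K p₀ C κ L N) (j : ℕ) (x : V) :
    x ∈ c.F j ↔ r x ≤ 2 ^ (2 * j) + 1 := by simp [CoreHyp.F]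

lemma CoreHyp.nbrF (c : CoreHyp μ w g u X r m p q H K p₀ C κ L N) {j : ℕ} (hj : 0 < j) {x : V}
    (hx : cutφ j (r x) ≠ 0) (y : V) (hy : 0 < μ x y) : y ∈ c.F j := by
  rw [c.memF]
  have h1 : r x < 2 ^ (2 * j) := by
    by_contra h
    exact hx (cutφ_zero hj (not_lt.mp h))
  have := c.edge x y hy
  omega

lemma CoreHyp.test (c : CoreHyp μ w g u X r m p q H K p₀ C κ L N) {j : ℕ} (hj : 0 < j) (h : V → ℝ)
    (hh : ∀ x, 0 ≤ h x) (hanti : ∀ x y, u x ≤ u y → h y ≤ h x)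
    (hH' : ∀ x y, 0 < μ x y → h y ≤ H * h x) :
    ∑ x ∈ c.F j, w x * X x * h x * cutφ j (r x) ^ κ
      + 1 / 2 * ∑ x ∈ c.F j, ∑ y ∈ c.F j, cutφ j (r x) ^ κ * (μ x y * |u y - u x| ^ (m - 1) * |h y - h x|)
    ≤ κ * H * K ^ (m - 1) *
      ∑ x ∈ c.F j, w x * (g x ^ (m - 1) * h x * cutφ j (r x) ^ (κ - 1) * cutG j (r x)) :=
  test_ineq (c.F j) μ c.symm c.nonneg w g u h (fun x => cutφ j (r x)) (fun x => cutG j (r x)) X m κ H K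
    c.hm c.κ1 (fun x => cutφ_nonneg _ _) hh c.gnn (fun x => cutG_nonneg _ _) (by linarith [c.hH]) c.hK.le
    hanti (fun x _ hx => c.lap x _ (c.nbrF hj hx)) (fun x _ hx => (c.wsum x _ (c.nbrF hj hx)).le)
    c.gup hH' (fun x y hxy => cutφ_diff hj (c.edge x y hxy))

lemma CoreHyp.hpow_H (c : CoreHyp μ w g u X r m p q H K p₀ C κ L N) {t : ℝ} (ht : 0 < t) (ht1 : t ≤ 1)
    (x y : V) (hxy : 0 < μ x y) : u y ^ (-t) ≤ H * u x ^ (-t) := by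
  have h1 : u x ≤ H * u y := c.har y x (by rwa [c.symm])
  have hH := c.hH
  have h2 := Real.rpow_le_rpow_of_nonpos (c.upos x) h1 (by linarith : -t ≤ 0)
  rw [Real.mul_rpow (by linarith) (c.upos y).le] at h2
  have h3 : 1 ≤ H * H ^ (-t) := by
    have : H * H ^ (-t) = H ^ (1 - t) := by
      rw [sub_eq_add_neg, Real.rpow_add (by linarith), Real.rpow_one]
    rw [this]
    exact Real.one_le_rpow hH (by linarith)
  have h4 : 0 ≤ u y ^ (-t) := Real.rpow_nonneg (c.upos y).le _
  calc u y ^ (-t) ≤ (H * H ^ (-t)) * u y ^ (-t) := le_mul_of_one_le_left h4 h3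
    _ = H * (H ^ (-t) * u y ^ (-t)) := by ring
    _ ≤ _ := by gcongr

lemma CoreHyp.Blow (c : CoreHyp μ w g u X r m p q H K p₀ C κ L N) {j : ℕ} (hj : 0 < j) {t : ℝ}
    (ht : 0 < t) (ht1 : t ≤ 1) :
    (p₀ * H ^ 2)⁻¹ * (t * ∑ x ∈ c.F j, w x * (g x ^ m * u x ^ (-1 - t)) * cutφ j (r x) ^ κ) ≤
    ∑ x ∈ c.F j, ∑ y ∈ c.F j,
      cutφ j (r x) ^ κ * (μ x y * |u y - u x| ^ (m - 1) * |u y ^ (-t) - u x ^ (-t)|) := by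
  have hp0 := c.hp0
  have hm := c.hm
  have hH := c.hH
  rw [Finset.mul_sum, Finset.mul_sum]
  refine Finset.sum_le_sum fun x hx => ?_
  have hnn : ∀ y ∈ c.F j, 0 ≤ cutφ j (r x) ^ κ * (μ x y * |u y - u x| ^ (m - 1) * |u y ^ (-t) - u x ^ (-t)|) := by
    intro y _
    have := c.nonneg x y
    have := cutφ_nonneg j (r x)
    positivity
  by_cases h0 : cutφ j (r x) = 0
  · rw [h0, Real.zero_rpow (by linarith [c.κ1])]; simp
  rcases (c.gnn x).eq_or_lt with hg | hg
  · rw [← hg, Real.zero_rpow (by linarith)]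
    simpa using Finset.sum_nonneg hnn
  obtain ⟨y, hxy, hgy⟩ := c.glow x hg
  refine le_trans ?_ (Finset.single_le_sum hnn (c.nbrF hj h0 y hxy))
  have h1 := negpow_lower (c.upos x) (c.upos y) ht ht1 hH (c.har x y hxy)
  have h2 : g x ^ (m - 1) ≤ |u y - u x| ^ (m - 1) := Real.rpow_le_rpow hg.le hgy (by linarith)
  have h3 : p₀⁻¹ * w x ≤ μ x y := by
    have := c.hp x y hxy
    rw [inv_mul_le_iff₀ (by linarith)]; exact this
  have hu := c.upos x
  have hw := c.wpos x
  have h4 : t * g x * ((H ^ 2)⁻¹ * u x ^ (-1 - t)) ≤ |u y ^ (-t) - u x ^ (-t)| := by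
    refine le_trans ?_ h1
    gcongr
  have e : g x ^ m = g x ^ (m - 1) * g x := by
    rw [← Real.rpow_add_one hg.ne']; ring_nf
  have := cutφ_nonneg j (r x)
  calc _ = cutφ j (r x) ^ κ * ((p₀⁻¹ * w x) * g x ^ (m - 1) * (t * g x * ((H ^ 2)⁻¹ * u x ^ (-1 - t)))) := by
        rw [e, mul_inv]; ring
    _ ≤ _ := by gcongr

end Core

section Core2
variable {μ : V → V → ℝ} {w g u X : V → ℝ} {r : V → ℕ} {m p q H K p₀ C κ L : ℝ} {N : ℕ}

/-- Summed weighted Young inequality. -/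
lemma CoreHyp.youngsum (c : CoreHyp μ w g u X r m p q H K p₀ C κ L N) (j : ℕ) (h X' Y : V → ℝ)
    {a b e l1 l2 l3 : ℝ} (ha : 0 ≤ a) (hb : 0 ≤ b) (he : 0 < e) (habc : a + b + e = 1)
    (h1 : 0 < l1) (h2 : 0 < l2) (h3 : 0 < l3) (hl : l1 ^ a * l2 ^ b * l3 ^ e = 1)
    (hX : ∀ x, 0 ≤ X' x) (hY : ∀ x, 0 ≤ Y x) (hcs : 1 / e ≤ κ)
    (hE : ∀ x, g x ^ (m - 1) * h x ≤ X' x ^ a * Y x ^ b) :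
    ∑ x ∈ c.F j, w x * (g x ^ (m - 1) * h x * cutφ j (r x) ^ (κ - 1) * cutG j (r x)) ≤
      l1 * ∑ x ∈ (c.F j).filter (fun x => 2 ^ j ≤ r x), w x * X' x * cutφ j (r x) ^ κ
      + l2 * ∑ x ∈ c.F j, w x * Y x * cutφ j (r x) ^ κ
      + l3 * ∑ x ∈ c.F j, w x * cutG j (r x) ^ (1 / e) := by
  rw [Finset.sum_filter, Finset.mul_sum, Finset.mul_sum, Finset.mul_sum, ← Finset.sum_add_distrib,
    ← Finset.sum_add_distrib]
  refine Finset.sum_le_sum fun x _ => ?_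
  have hw := c.wpos x
  have hφ := cutφ_nonneg j (r x)
  have hG := cutG_nonneg j (r x)
  by_cases hr : 2 ^ j ≤ r x
  · rw [if_pos hr]
    have := mul_le_mul_of_nonneg_left (young_pt ha hb he habc h1 h2 h3 hl (hX x) (hY x)
      (cutφ_nonneg j (r x)) (cutφ_le_one j (r x)) (cutG_nonneg j (r x)) c.κ1 hcs (hE x)) hw.le
    refine this.trans (le_of_eq ?_)
    ring
  · rw [if_neg hr]
    have : cutG j (r x) = 0 := by
      unfold cutG; rw [if_neg]; tauto
    have n1 := hY x
    have n2 : 0 ≤ l2 * (w x * Y x * cutφ j (r x) ^ κ) := by positivity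
    have n3 : 0 ≤ l3 * (w x * cutG j (r x) ^ (1 / e)) := by positivity
    rw [this] at n3 ⊢
    simp only [mul_zero, zero_add]
    linarith

lemma CoreHyp.step1 (c : CoreHyp μ w g u X r m p q H K p₀ C κ L N) :
    ∃ C3 : ℝ, 0 < C3 ∧ ∀ᶠ j : ℕ in Filter.atTop,
      ∑ x ∈ c.F j, w x * X x * u x ^ (-(1 / (j : ℝ))) * cutφ j (r x) ^ κ ≤ C3 ∧
      1 / (j : ℝ) * ∑ x ∈ c.F j, w x * (g x ^ m * u x ^ (-1 - 1 / (j : ℝ))) * cutφ j (r x) ^ κ ≤ C3 := by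
  have hm := c.hm
  have hp := c.hp'
  have hq := c.hq
  have hS := c.hS
  have hκ1 := c.κ1
  have hL0 := c.L0
  have hC := c.hC
  have hH := c.hH
  have hK := c.hK
  have hp0 := c.hp0
  set S := p + q - m + 1 with hSdef
  set θ := (m - q) / S with hθ
  have hθ0 : 0 ≤ θ := div_nonneg (by linarith) hS.le
  have hκS : κ * S = m * p + q := by rw [c.hκ, ← hSdef]; field_simp
  have hLS : L * S = m - 1 := by rw [c.hL, ← hSdef]; field_simp
  have hθS : θ * S = m - q := by rw [hθ]; field_simp
  set C1 := κ * H * K ^ (m - 1) with hC1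
  have hC1pos : 0 < C1 := by positivity
  set c1 := (p₀ * H ^ 2)⁻¹ with hc1
  have hc1pos : 0 < c1 := by positivity
  set ε := min 1 (min (1 / (2 * C1)) (c1 / (4 * C1))) with hε
  have hεpos : 0 < ε := by positivity
  have hε1 : ε ≤ 1 := min_le_left _ _
  have hε2 : C1 * ε ≤ 1 / 2 := by
    have : ε ≤ 1 / (2 * C1) := (min_le_right _ _).trans (min_le_left _ _)
    rw [le_div_iff₀ (by positivity)] at this; linarith
  have hε3 : C1 * ε ≤ c1 / 4 := by
    have : ε ≤ c1 / (4 * C1) := (min_le_right _ _).trans (min_le_right _ _)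
    rw [le_div_iff₀ (by positivity)] at this; linarith
  set C4 := (2 : ℝ) ^ κ * 2 ^ (2 * θ) * (C * 2 ^ κ * 2 ^ L) with hC4
  have hC4pos : 0 < C4 := by positivity
  set R := ε ^ (1 - κ) * C4 * Real.exp (1 / S) with hR
  have hRpos : 0 < R := by positivity
  refine ⟨2 * C1 * R + 4 * C1 * R / c1, by positivity, ?_⟩
  have hlim := tendsto_one_div_atTop_nhds_zero_nat (𝕜 := ℝ)
  have ev1 : ∀ᶠ j : ℕ in Filter.atTop, 1 / (j : ℝ) < (m - 1) := hlim.eventually_lt_const (by linarith)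
  have ev2 : ∀ᶠ j : ℕ in Filter.atTop, 1 / (j : ℝ) * θ < κ :=
    (by simpa using hlim.mul_const θ : Filter.Tendsto (fun j : ℕ => 1 / (j : ℝ) * θ) Filter.atTop (nhds 0)).eventually_lt_const
      (by linarith)
  filter_upwards [ev1, ev2, Filter.eventually_ge_atTop N, Filter.eventually_ge_atTop 1] with j e1 e2 hjN hj1
  have hj : 0 < j := hj1
  have hj' : (1 : ℝ) ≤ j := by exact_mod_cast hj1
  have hZ := annulus_Z w r (fun x => (c.wpos x).le) C κ L hC (by linarith) hL0 N c.vol θ hθ0 j hj hjN (c.F j)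
    (by linarith)
  have htlog : (1 / (j : ℝ)) ^ (-(1 / (j : ℝ)) / S) ≤ Real.exp (1 / S) := by
    rw [Real.rpow_def_of_pos (by positivity), one_div, Real.log_inv]
    refine Real.exp_le_exp.mpr ?_
    have h1 : Real.log j ≤ j := (Real.log_le_sub_one_of_pos (by linarith)).trans (by linarith)
    have h2 : Real.log j * (j : ℝ)⁻¹ ≤ 1 := by
      rw [← div_eq_mul_inv, div_le_one (by linarith)]; exact h1
    calc -Real.log j * (-(j : ℝ)⁻¹ / S) = (Real.log j * (j : ℝ)⁻¹) / S := by ring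
      _ ≤ 1 / S := by gcongr
  set t := 1 / (j : ℝ) with ht
  have ht0 : 0 < t := by positivity
  have ht1 : t ≤ 1 := by rw [ht, div_le_one (by linarith)]; exact hj'
  set κ' := κ - t * θ with hκ'
  have hκ'0 : 0 < κ' := by linarith
  have hκ'le : κ' ≤ κ := by have : 0 ≤ t * θ := by positivity
                            linarith
  have hM : κ' * S = m * p + q - t * (m - q) := by
    rw [hκ', sub_mul, hκS, mul_assoc, hθS]
  -- exponents
  set a := (m - 1 - t) / (κ' * S) with ha
  set e := 1 / κ' with he
  set b := a * p + t * e with hb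
  have hMpos : 0 < κ' * S := by positivity
  have ha0 : 0 ≤ a := div_nonneg (by linarith) hMpos.le
  have he0 : 0 < e := by positivity
  have hb0 : 0 ≤ b := by positivity
  have haM : a * (κ' * S) = m - 1 - t := by rw [ha]; field_simp
  have heM : e * (κ' * S) = S := by rw [he]; field_simp
  have hsum : a + b + e = 1 := by
    have : (a + b + e) * (κ' * S) = 1 * (κ' * S) := by
      rw [hb]
      have : (a + (a * p + t * e) + e) * (κ' * S) = (1 + p) * (a * (κ' * S)) + (1 + t) * (e * (κ' * S)) := by ring
      rw [this, haM, heM, hM, hSdef]; ring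
    exact mul_right_cancel₀ hMpos.ne' this
  have hqm : q * a + m * b = m - 1 := by
    have : (q * a + m * b) * (κ' * S) = (m - 1) * (κ' * S) := by
      rw [hb]
      have : (q * a + m * (a * p + t * e)) * (κ' * S) = (q + m * p) * (a * (κ' * S)) + m * t * (e * (κ' * S)) := by ring
      rw [this, haM, heM, hM, hSdef]; ring
    exact mul_right_cancel₀ hMpos.ne' this
  have hux : (p + -t) * a + (-1 - t) * b = -t := by
    have h1 : b = a * p + t * e := hb
    linear_combination (-t) * hsum + (-1 : ℝ) * h1
  have h1e : 1 / e = κ' := by rw [he, one_div_one_div]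
  have heκ : e * κ' = 1 := by rw [he]; field_simp
  have hbκ : κ' - 1 - L - b * κ' = -t / S := by
    have h1 : a * κ' = L - t / S := by
      have : a * κ' * S = (L - t / S) * S := by
        rw [sub_mul, hLS, div_mul_cancel₀ _ hS.ne']; linarith
      exact mul_right_cancel₀ hS.ne' this
    have : (a + b + e) * κ' = κ' := by rw [hsum, one_mul]
    have h3 : -t / S = - (t / S) := by ring
    rw [h3]
    linear_combination (-1 : ℝ) * this + h1 + heκ
  -- test inequality
  have hT := c.test hj (fun x => u x ^ (-t)) (fun x => Real.rpow_nonneg (c.upos x).le _)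
    (fun x y hxy => Real.rpow_le_rpow_of_nonpos (c.upos x) hxy (by linarith))
    (fun x y hxy => c.hpow_H ht0 ht1 x y hxy)
  have hB := c.Blow hj ht0 ht1
  have hY := c.youngsum j (fun x => u x ^ (-t)) (fun x => X x * u x ^ (-t)) (fun x => g x ^ m * u x ^ (-1 - t))
    (l1 := ε) (l2 := ε * t) (l3 := ε ^ (1 - κ') * t ^ (-(b * κ'))) ha0 hb0 he0 hsum hεpos (by positivity) (by positivity)
    (by
      rw [Real.mul_rpow hεpos.le ht0.le, Real.mul_rpow (by positivity) (by positivity), ← Real.rpow_mul hεpos.le,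
        ← Real.rpow_mul ht0.le]
      have : ε ^ a * (ε ^ b * t ^ b) * (ε ^ ((1 - κ') * e) * t ^ (-(b * κ') * e)) =
        (ε ^ a * ε ^ b * ε ^ ((1 - κ') * e)) * (t ^ b * t ^ (-(b * κ') * e)) := by ring
      rw [this, ← Real.rpow_add hεpos, ← Real.rpow_add hεpos, ← Real.rpow_add ht0]
      have z1 : a + b + (1 - κ') * e = 0 := by linear_combination hsum - heκ
      have z2 : b + -(b * κ') * e = 0 := by linear_combination (-b) * heκ
      rw [z1, z2]; simp)
    (fun x => mul_nonneg (c.Xnn x) (Real.rpow_nonneg (c.upos x).le _))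
    (fun x => mul_nonneg (Real.rpow_nonneg (c.gnn x) _) (Real.rpow_nonneg (c.upos x).le _))
    (by rw [h1e]; exact hκ'le)
    (by
      intro x
      rcases (c.gnn x).eq_or_lt with hg | hg
      · rw [← hg, Real.zero_rpow (by linarith), zero_mul]
        have := c.Xnn x
        have := c.upos x
        positivity
      · simp only [c.Xdef]
        rw [pow_split (c.upos x) hg, hqm, hux, mul_comm])
  rw [h1e] at hY
  set A := ∑ x ∈ c.F j, w x * X x * u x ^ (-t) * cutφ j (r x) ^ κ with hA
  set B := ∑ x ∈ c.F j, w x * (g x ^ m * u x ^ (-1 - t)) * cutφ j (r x) ^ κ with hBdef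
  have hXle : ∑ x ∈ (c.F j).filter (fun x => 2 ^ j ≤ r x), w x * (X x * u x ^ (-t)) * cutφ j (r x) ^ κ ≤ A := by
    have : A = ∑ x ∈ c.F j, w x * (X x * u x ^ (-t)) * cutφ j (r x) ^ κ :=
      Finset.sum_congr rfl fun x _ => by ring
    rw [this]
    refine Finset.sum_le_sum_of_subset_of_nonneg (Finset.filter_subset _ _) fun x _ _ => ?_
    have := c.Xnn x
    have := c.upos x
    have := c.wpos x
    have := cutφ_nonneg j (r x)
    positivity
  have hA0 : 0 ≤ A := Finset.sum_nonneg fun x _ => by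
    have := c.Xnn x
    have := c.upos x
    have := c.wpos x
    have := cutφ_nonneg j (r x)
    positivity
  have hB0 : 0 ≤ B := Finset.sum_nonneg fun x _ => by
    have := c.gnn x
    have := c.upos x
    have := c.wpos x
    have := cutφ_nonneg j (r x)
    positivity
  have hZ2 : ε ^ (1 - κ') * t ^ (-(b * κ')) * ∑ x ∈ c.F j, w x * cutG j (r x) ^ κ' ≤ R := by
    calc _ ≤ ε ^ (1 - κ) * t ^ (-(b * κ')) * (C4 * t ^ (κ' - 1 - L)) := by
          have : ε ^ (1 - κ') ≤ ε ^ (1 - κ) := Real.rpow_le_rpow_of_exponent_ge hεpos hε1 (by linarith)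
          have hnn : 0 ≤ ∑ x ∈ c.F j, w x * cutG j (r x) ^ κ' := Finset.sum_nonneg fun x _ => by
            have := c.wpos x
            have := cutG_nonneg j (r x)
            positivity
          gcongr
      _ = ε ^ (1 - κ) * C4 * (t ^ (-t / S)) := by
          rw [← hbκ, sub_eq_add_neg (κ' - 1 - L), Real.rpow_add ht0]; ring
      _ ≤ R := by rw [hR]; gcongr
  have hY2 : ∑ x ∈ c.F j, w x * (g x ^ (m - 1) * u x ^ (-t) * cutφ j (r x) ^ (κ - 1) * cutG j (r x)) ≤
      ε * A + ε * t * B + R := by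
    refine hY.trans ?_
    have := mul_le_mul_of_nonneg_left hXle hεpos.le
    linarith
  have hfin : A + 1 / 2 * (c1 * (t * B)) ≤ C1 * (ε * A + ε * t * B + R) := by
    have := mul_le_mul_of_nonneg_left hY2 hC1pos.le
    linarith
  have htB : 0 ≤ t * B := by positivity
  have k1 := mul_le_mul_of_nonneg_right hε2 hA0
  have k2 := mul_le_mul_of_nonneg_right hε3 htB
  have k3 : A / 2 + c1 / 4 * (t * B) ≤ C1 * R := by linarith
  have hx1 : 0 ≤ c1 / 4 * (t * B) := by positivity
  have hx2 : 0 ≤ 4 * C1 * R / c1 := by positivity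
  have hx3 : 0 ≤ 2 * C1 * R := by positivity
  constructor
  · linarith
  · have : t * B ≤ 4 * C1 * R / c1 := by
      rw [le_div_iff₀ hc1pos]; linarith
    linarith

end Core2

section Core3
variable {μ : V → V → ℝ} {w g u X : V → ℝ} {r : V → ℕ} {m p q H K p₀ C κ L : ℝ} {N : ℕ}

lemma CoreHyp.summ (c : CoreHyp μ w g u X r m p q H K p₀ C κ L N) :
    Summable fun x => w x * X x := by
  obtain ⟨C3, hC3, hev⟩ := c.step1
  refine summable_of_sum_le (c := C3) (fun x => mul_nonneg (c.wpos x).le (c.Xnn x)) fun S => ?_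
  have hlim := tendsto_one_div_atTop_nhds_zero_nat (𝕜 := ℝ)
  have ht : Filter.Tendsto (fun j : ℕ => ∑ x ∈ S, w x * X x * u x ^ (-(1 / (j : ℝ)))) Filter.atTop
      (nhds (∑ x ∈ S, w x * X x)) := by
    refine tendsto_finsetSum _ fun x _ => ?_
    have h1 : Filter.Tendsto (fun j : ℕ => u x ^ (-(1 / (j : ℝ)))) Filter.atTop (nhds (u x ^ (-(0:ℝ)))) :=
      (tendsto_const_nhds).rpow hlim.neg (Or.inl (c.upos x).ne')
    simpa using h1.const_mul (w x * X x)
  refine le_of_tendsto ht ?_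
  filter_upwards [hev, Filter.eventually_ge_atTop 1, Filter.eventually_ge_atTop (S.sup r)] with j hj hj1 hjS
  refine le_trans ?_ hj.1
  have hr : ∀ x ∈ S, r x ≤ 2 ^ j := fun x hx =>
    ((Finset.le_sup (f := r) hx).trans hjS).trans Nat.lt_two_pow_self.le
  have hsub : S ⊆ c.F j := by
    intro x hx
    rw [c.memF]
    have h1 : 2 ^ j ≤ 2 ^ (2 * j) := Nat.pow_le_pow_right (by norm_num) (by omega)
    have := hr x hx
    omega
  calc ∑ x ∈ S, w x * X x * u x ^ (-(1 / (j : ℝ))) = ∑ x ∈ S, w x * X x * u x ^ (-(1 / (j : ℝ))) * cutφ j (r x) ^ κ := by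
        refine Finset.sum_congr rfl fun x hx => ?_
        rw [cutφ_one hj1 (hr x hx), Real.one_rpow, mul_one]
    _ ≤ _ := by
        refine Finset.sum_le_sum_of_subset_of_nonneg hsub fun x _ _ => ?_
        have := c.Xnn x
        have := c.upos x
        have := c.wpos x
        have := cutφ_nonneg j (r x)
        positivity

set_option maxHeartbeats 2000000 in
lemma CoreHyp.step2 (c : CoreHyp μ w g u X r m p q H K p₀ C κ L N) :
    ∃ C5 : ℝ, 0 < C5 ∧ ∀ δ : ℝ, 0 < δ → ∃ l1 : ℝ, 0 < l1 ∧ ∀ᶠ j : ℕ in Filter.atTop,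
      ∑ x ∈ c.F j, w x * X x * min 1 (u x ^ (-(1 / (j : ℝ)))) * cutφ j (r x) ^ κ ≤
        C5 * (l1 * ∑ x ∈ (c.F j).filter (fun x => 2 ^ j ≤ r x), w x * X x + δ) := by
  obtain ⟨C3, hC3, hev⟩ := c.step1
  have hm := c.hm
  have hp := c.hp'
  have hq := c.hq
  have hS := c.hS
  have hκ1 := c.κ1
  have hL0 := c.L0
  have hC := c.hC
  have hH := c.hH
  have hK := c.hK
  set S := p + q - m + 1 with hSdef
  have hκS : κ * S = m * p + q := by rw [c.hκ, ← hSdef]; field_simp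
  have hLS : L * S = m - 1 := by rw [c.hL, ← hSdef]; field_simp
  set C1 := κ * H * K ^ (m - 1) with hC1
  have hC1pos : 0 < C1 := by positivity
  set C4 := (2 : ℝ) ^ κ * 2 ^ (2 * (0:ℝ)) * (C * 2 ^ κ * 2 ^ L) with hC4
  have hC4pos : 0 < C4 := by positivity
  -- exponents
  set a := L / κ with ha
  set e := 1 / κ with he
  set b := a * p with hb
  have ha0 : 0 < a := by positivity
  have he0 : 0 < e := by positivity
  have hb0 : 0 ≤ b := by positivity
  have haκ : a * κ = L := by rw [ha]; field_simp
  have heκ : e * κ = 1 := by rw [he]; field_simp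
  have hMpos : 0 < κ * S := by positivity
  have hsum : a + b + e = 1 := by
    have : (a + b + e) * (κ * S) = 1 * (κ * S) := by
      rw [hb]
      have : (a + a * p + e) * (κ * S) = (1 + p) * (a * κ * S) + (e * κ) * S := by ring
      rw [this, haκ, heκ, hLS, hκS, hSdef]; ring
    exact mul_right_cancel₀ hMpos.ne' this
  have hqm : q * a + m * b = m - 1 := by
    have : (q * a + m * b) * (κ * S) = (m - 1) * (κ * S) := by
      rw [hb]
      have : (q * a + m * (a * p)) * (κ * S) = (q + m * p) * (a * κ * S) := by ring
      rw [this, haκ, hLS, hκS]; ring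
    exact mul_right_cancel₀ hMpos.ne' this
  have h1e : 1 / e = κ := by rw [he, one_div_one_div]
  have hbκ : κ - 1 - L - b * κ = 0 := by
    have : (a + b + e) * κ = κ := by rw [hsum, one_mul]
    linear_combination (-1 : ℝ) * this + haκ + heκ
  refine ⟨C1 * (1 + C3 + C4), by positivity, fun δ hδ => ?_⟩
  set l1 := δ ^ (-(b + e) / a) with hl1
  have hl1pos : 0 < l1 := by positivity
  refine ⟨l1, hl1pos, ?_⟩
  filter_upwards [hev, Filter.eventually_ge_atTop N, Filter.eventually_ge_atTop 1] with j hevj hjN hj1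
  have hj : 0 < j := hj1
  have hj' : (1 : ℝ) ≤ j := by exact_mod_cast hj1
  have hZ := annulus_Z w r (fun x => (c.wpos x).le) C κ L hC (by linarith) hL0 N c.vol 0 le_rfl j hj hjN (c.F j)
    (by linarith)
  rw [mul_zero, sub_zero] at hZ
  have hBj := hevj.2
  set t := 1 / (j : ℝ) with ht
  have ht0 : 0 < t := by positivity
  have ht1 : t ≤ 1 := by rw [ht, div_le_one (by linarith)]; exact hj'
  have hT := c.test hj (fun x => min 1 (u x ^ (-t)))
    (fun x => le_min zero_le_one (Real.rpow_nonneg (c.upos x).le _))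
    (fun x y hxy => min_le_min_left _ (Real.rpow_le_rpow_of_nonpos (c.upos x) hxy (by linarith)))
    (fun x y hxy => by
      have h1 := c.hpow_H ht0 ht1 x y hxy
      rw [mul_min_of_nonneg _ _ (by linarith : 0 ≤ H), mul_one]
      exact min_le_min hH h1)
  have hY := c.youngsum j (fun x => min 1 (u x ^ (-t))) X (fun x => g x ^ m * u x ^ (-1 - t))
    (l1 := l1) (l2 := δ * t) (l3 := δ * t ^ (-(b * κ))) ha0.le hb0 he0 hsum hl1pos (by positivity) (by positivity)
    (by
      rw [Real.mul_rpow hδ.le ht0.le, Real.mul_rpow (by positivity) (by positivity), hl1, ← Real.rpow_mul hδ.le,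
        ← Real.rpow_mul ht0.le]
      have : δ ^ (-(b + e) / a * a) * (δ ^ b * t ^ b) * (δ ^ e * t ^ (-(b * κ) * e)) =
        (δ ^ (-(b + e) / a * a) * δ ^ b * δ ^ e) * (t ^ b * t ^ (-(b * κ) * e)) := by ring
      rw [this, ← Real.rpow_add hδ, ← Real.rpow_add hδ, ← Real.rpow_add ht0, div_mul_cancel₀ _ ha0.ne']
      have z1 : -(b + e) + b + e = 0 := by ring
      have z2 : b + -(b * κ) * e = 0 := by linear_combination (-b) * heκ
      rw [z1, z2]; simp)
    c.Xnn
    (fun x => mul_nonneg (Real.rpow_nonneg (c.gnn x) _) (Real.rpow_nonneg (c.upos x).le _))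
    (by rw [h1e])
    (by
      intro x
      have hu := c.upos x
      rcases (c.gnn x).eq_or_lt with hg | hg
      · rw [← hg, Real.zero_rpow (by linarith), zero_mul]
        have := c.Xnn x
        positivity
      · have hs := pow_split (p := p) (q := q) (m := m) (t := t) (z := 0) (a := a) (b := b) hu hg
        rw [Real.rpow_zero, mul_one, hqm] at hs
        simp only [c.Xdef]
        rw [hs, mul_comm]
        refine mul_le_mul_of_nonneg_right ?_ (by positivity)
        have hexp : (p + 0) * a + (-1 - t) * b = -(t * b) := by rw [hb]; ring
        rw [hexp]
        rcases le_total 1 (u x) with h1 | h1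
        · refine (min_le_right _ _).trans (Real.rpow_le_rpow_of_exponent_le h1 ?_)
          nlinarith
        · refine (min_le_left _ _).trans (Real.one_le_rpow_of_pos_of_le_one_of_nonpos hu h1 ?_)
          have : 0 ≤ t * b := by positivity
          linarith)
  rw [h1e] at hY
  have hXle : ∑ x ∈ (c.F j).filter (fun x => 2 ^ j ≤ r x), w x * X x * cutφ j (r x) ^ κ ≤
      ∑ x ∈ (c.F j).filter (fun x => 2 ^ j ≤ r x), w x * X x := by
    refine Finset.sum_le_sum fun x _ => ?_
    exact mul_le_of_le_one_right (mul_nonneg (c.wpos x).le (c.Xnn x))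
      (Real.rpow_le_one (cutφ_nonneg _ _) (cutφ_le_one _ _) (by linarith))
  have hZ2 : δ * t ^ (-(b * κ)) * ∑ x ∈ c.F j, w x * cutG j (r x) ^ κ ≤ δ * C4 := by
    calc _ ≤ δ * t ^ (-(b * κ)) * (C4 * t ^ (κ - 1 - L)) := by gcongr
      _ = δ * C4 * (t ^ (-(b * κ)) * t ^ (κ - 1 - L)) := by ring
      _ = δ * C4 := by
        rw [← Real.rpow_add ht0]
        have : -(b * κ) + (κ - 1 - L) = 0 := by linarith
        rw [this, Real.rpow_zero, mul_one]
  have hB2 := mul_le_mul_of_nonneg_left hBj hδ.le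
  have hnn : 0 ≤ 1 / 2 * ∑ x ∈ c.F j, ∑ y ∈ c.F j, cutφ j (r x) ^ κ *
      (μ x y * |u y - u x| ^ (m - 1) * |min 1 (u y ^ (-t)) - min 1 (u x ^ (-t))|) := by
    refine mul_nonneg (by norm_num) (Finset.sum_nonneg fun x _ => Finset.sum_nonneg fun y _ => ?_)
    have := c.nonneg x y
    have := cutφ_nonneg j (r x)
    positivity
  set T := ∑ x ∈ (c.F j).filter (fun x => 2 ^ j ≤ r x), w x * X x with hTdef
  have hT0 : 0 ≤ T := Finset.sum_nonneg fun x _ => mul_nonneg (c.wpos x).le (c.Xnn x)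
  have h1 := mul_le_mul_of_nonneg_left hXle hl1pos.le
  have h2 : ∑ x ∈ c.F j, w x * (g x ^ (m - 1) * min 1 (u x ^ (-t)) * cutφ j (r x) ^ (κ - 1) * cutG j (r x)) ≤
      l1 * T + δ * C3 + δ * C4 := by linarith
  have h3 := mul_le_mul_of_nonneg_left h2 hC1pos.le
  have h4 : l1 * T + δ * C3 + δ * C4 ≤ (1 + C3 + C4) * (l1 * T + δ) := by
    have : 0 ≤ l1 * T := by positivity
    have e1 : (1 + C3 + C4) * (l1 * T + δ) = l1 * T + δ * C3 + δ * C4 + (C3 * (l1 * T) + C4 * (l1 * T) + δ) := by ring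
    rw [e1]
    have e2 := mul_nonneg hC3.le this
    have e3 := mul_nonneg hC4pos.le this
    linarith
  have h5 := mul_le_mul_of_nonneg_left h4 hC1pos.le
  linarith

lemma CoreHyp.final (c : CoreHyp μ w g u X r m p q H K p₀ C κ L N) (x : V) : X x = 0 := by
  obtain ⟨C5, hC5, h5⟩ := c.step2
  have key : ∀ δ : ℝ, 0 < δ → w x * X x ≤ C5 * (2 * δ) := by
    intro δ hδ
    obtain ⟨l1, hl1, hev⟩ := h5 δ hδ
    obtain ⟨s, hs⟩ := summable_iff_vanishing_norm.1 c.summ (δ / l1) (by positivity)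
    have hlim := tendsto_one_div_atTop_nhds_zero_nat (𝕜 := ℝ)
    have ht : Filter.Tendsto (fun j : ℕ => w x * X x * min 1 (u x ^ (-(1 / (j : ℝ))))) Filter.atTop
        (nhds (w x * X x)) := by
      have h1 : Filter.Tendsto (fun j : ℕ => u x ^ (-(1 / (j : ℝ)))) Filter.atTop (nhds (u x ^ (-(0:ℝ)))) :=
        (tendsto_const_nhds).rpow hlim.neg (Or.inl (c.upos x).ne')
      have h2 := ((tendsto_const_nhds (x := (1:ℝ))).min h1).const_mul (w x * X x)
      simpa using h2
    refine le_of_tendsto ht ?_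
    filter_upwards [hev, Filter.eventually_ge_atTop 1, Filter.eventually_ge_atTop (s.sup r),
      Filter.eventually_ge_atTop (r x)] with j hj hj1 hjs hjx
    have hlt : j < 2 ^ j := Nat.lt_two_pow_self
    have hd : Disjoint ((c.F j).filter (fun x => 2 ^ j ≤ r x)) s := by
      rw [Finset.disjoint_left]
      intro y hy hys
      have h1 := (Finset.mem_filter.1 hy).2
      have h2 := Finset.le_sup (f := r) hys
      omega
    have hT := (le_abs_self _).trans (hs _ hd).le
    rw [le_div_iff₀ hl1] at hT
    have hx : x ∈ c.F j := by
      rw [c.memF]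
      have h1 : 2 ^ j ≤ 2 ^ (2 * j) := Nat.pow_le_pow_right (by norm_num) (by omega)
      omega
    have hsing := Finset.single_le_sum
      (f := fun x => w x * X x * min 1 (u x ^ (-(1 / (j : ℝ)))) * cutφ j (r x) ^ κ) (fun y _ => by
        have := c.Xnn y
        have := c.upos y
        have := c.wpos y
        have := cutφ_nonneg j (r y)
        positivity) hx
    try beta_reduce at hsing
    rw [cutφ_one (r := r x) hj1 (by omega), Real.one_rpow, mul_one] at hsing
    refine (hsing.trans hj).trans (mul_le_mul_of_nonneg_left ?_ hC5.le)
    linarith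
  have h0 : w x * X x ≤ 0 := by
    by_contra hcon
    push Not at hcon
    have := key (w x * X x / (4 * C5)) (by positivity)
    have e : C5 * (2 * (w x * X x / (4 * C5))) = w x * X x / 2 := by field_simp; ring
    rw [e] at this
    linarith
  have h1 := c.Xnn x
  have h2 := c.wpos x
  nlinarith [mul_nonneg h2.le h1, mul_eq_zero.1 (le_antisymm h0 (mul_nonneg h2.le h1)) |>.resolve_left h2.ne']

end Core3

theorem statement4
    (G : SimpleGraph V) (μ : V → V → ℝ)
    (hsymm : ∀ x y, μ x y = μ y x)
    (hnonneg : ∀ x y, 0 ≤ μ x y)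
    (hadj : ∀ x y, 0 < μ x y ↔ G.Adj x y)
    (hinf : Infinite V) (hconn : G.Connected)
    (hlf : ∀ x, (G.neighborSet x).Finite)
    (p₀ : ℝ) (hp₀ : 1 < p₀)
    (hcond : ∀ x y, G.Adj x y → 1 / p₀ ≤ μ x y / vMeasure μ x)
    (m p q : ℝ) (hm : 1 < m)
    (hp : 0 ≤ p) (hq1 : m - 1 - p < q) (hq2 : q < m)
    (o : V) (C : ℝ) (hC : 0 < C) (N : ℕ)
    (hW : ∀ n : ℕ, N ≤ n →
      Wvol G μ o n ≤
        C * (n : ℝ) ^ ((m * p + q) / (p + q - m + 1)) *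
          (Real.log n) ^ ((m - 1) / (p + q - m + 1)))
    (u : V → ℝ) (hu : ∀ x, 0 < u x)
    (hgrad : ∀ x, q < 0 → 0 < gradNorm μ u x)
    (hsol : ∀ x, lapM μ m u x + u x ^ p * gradNorm μ u x ^ q ≤ 0) :
    ∃ c : ℝ, ∀ x, u x = c := by
  have hw := vM_pos G μ hnonneg hadj hinf hconn hlf
  have hp0' : ∀ x y, G.Adj x y → vMeasure μ x ≤ p₀ * μ x y := fun x y h => p0_aux G μ p₀ hp₀ hcond (hw x) h
  have hS : 0 < p + q - m + 1 := by linarith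
  have hXnn : ∀ x, 0 ≤ u x ^ p * gradNorm μ u x ^ q := fun x =>
    mul_nonneg (Real.rpow_nonneg (hu x).le _) (Real.rpow_nonneg (Real.sqrt_nonneg _) _)
  have core : CoreHyp μ (vMeasure μ) (gradNorm μ u) u (fun x => u x ^ p * gradNorm μ u x ^ q)
      (fun x => G.dist o x) m p q (1 + p₀ ^ (1 / (m - 1))) (Real.sqrt (2 * p₀)) p₀ (p₀ * C)
      ((m * p + q) / (p + q - m + 1)) ((m - 1) / (p + q - m + 1)) N :=
    { symm := hsymm
      nonneg := hnonneg
      ball := ball_finite G hconn hlf o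
      edge := by
        intro x y hxy
        have := hconn.dist_triangle (u := o) (v := x) (w := y)
        rwa [SimpleGraph.dist_eq_one_iff_adj.mpr ((hadj x y).1 hxy)] at this
      wpos := hw
      wsum := fun x F hF => (vM_eq G μ hnonneg hadj x F fun y hy => hF y ((hadj x y).2 hy)).symm
      lap := fun x F hF => lap_sum G μ hnonneg hadj m u (fun x => u x ^ p * gradNorm μ u x ^ q) x F
        (fun y hy => hF y ((hadj x y).2 hy)) (hw x) (hsol x)
      Xdef := fun x => rfl
      upos := hu
      gnn := fun x => Real.sqrt_nonneg _
      hm := hm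
      hH := by
        have : 0 ≤ p₀ ^ (1 / (m - 1)) := Real.rpow_nonneg (by linarith) _
        linarith
      hK := Real.sqrt_pos.2 (by linarith)
      hp0 := hp₀
      har := fun x y hxy => harnack_aux G μ hnonneg hadj hlf p₀ hp₀ m hm u
        (fun x => u x ^ p * gradNorm μ u x ^ q) x y hu (hXnn x) (hw x) (hp0' x y ((hadj x y).1 hxy)) (hsol x)
        ((hadj x y).1 hxy)
      gup := fun x y hxy => grad_upper G μ hnonneg hadj hlf u x y (hw x) p₀ hp₀ (hp0' x y ((hadj x y).1 hxy))
        ((hadj x y).1 hxy)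
      glow := fun x hx => by
        obtain ⟨y, hy, h⟩ := grad_lower G μ hnonneg hadj hlf u x (hw x) hx
        exact ⟨y, (hadj x y).2 hy, h⟩
      hp := fun x y hxy => hp0' x y ((hadj x y).1 hxy)
      hC := by positivity
      hp' := hp
      hS := hS
      hq := hq2
      hκ := rfl
      hL := rfl
      vol := fun n hn S hSS => by
        have h1 := vol_le_W G μ hsymm hnonneg hadj hconn hlf p₀ hp₀ hp0' o n S hSS
        have h2 := mul_le_mul_of_nonneg_left (hW n hn) (by linarith : 0 ≤ p₀)
        refine h1.trans (h2.trans (le_of_eq (by ring))) }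
  have hg : ∀ x, gradNorm μ u x = 0 := by
    intro x
    by_contra hne
    have hpos : 0 < gradNorm μ u x := lt_of_le_of_ne (Real.sqrt_nonneg _) (Ne.symm hne)
    have := core.final x
    have h2 : 0 < u x ^ p * gradNorm μ u x ^ q :=
      mul_pos (Real.rpow_pos_of_pos (hu x) _) (Real.rpow_pos_of_pos hpos _)
    exact h2.ne' this
  have hadj_eq : ∀ x y, G.Adj x y → u x = u y := by
    intro x y hxy
    have := core.gup x y ((hadj x y).2 hxy)
    rw [hg x, mul_zero] at this
    have := abs_nonpos_iff.1 this
    linarith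
  have hwalk : ∀ x y, G.Reachable x y → u x = u y := by
    clear core hW
    rintro x y ⟨wk⟩
    induction wk with
    | nil => rfl
    | cons h _ ih => exact (hadj_eq _ _ h).trans ih
  exact ⟨u o, fun x => hwalk x o (hconn.preconnected x o)⟩
end

section
/- Let m>1 and suppose p ≥ 0 and m−1−p < q < m (region G₁). Then for every ε>0 there exists an edge weight μ on the homogeneous tree T_N and a nonconstant positive function u on T_N such that W_o(n) ≍ n^{(mp+q)/(p+q−m+1)}·(ln n)^{(m−1)/(p+q−m+1)+ε} for all n ≥ 2, and u satisfies Δ_m u(x) + u(x)^p·|∇u(x)|^q ≤ 0 at every vertex x of T_N; i.e., (★) admits a nontrivial positive solution on (T_N, μ). -/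
variable {V : Type*}

lemma tree_parent {V : Type*} (G : SimpleGraph V) (ht : G.IsTree) (o x : V) (k : ℕ)
    (hx : G.dist o x = k + 1) : ∃ y, (G.Adj x y ∧ G.dist o y = k) ∧
      ∀ z, G.Adj x z → G.dist o z = k → z = y := by
  obtain ⟨P, hP, hl⟩ := ht.connected.exists_path_of_dist o x
  have key : ∀ z, G.Adj x z → G.dist o z = k → z = P.penultimate := by
    intro z hz hd
    obtain ⟨Q, hQ, hQl⟩ := ht.connected.exists_path_of_dist o z
    have h1 : (Q.concat hz.symm).IsPath := by
      apply SimpleGraph.Walk.isPath_of_length_eq_dist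
      rw [SimpleGraph.Walk.length_concat, hQl, hd, hx]
    have h2 : Q.concat hz.symm = P := (ht.existsUnique_path o x).unique h1 hP
    rw [← h2]; simp
  have hnil : ¬ P.Nil := by
    intro h
    have := SimpleGraph.Walk.length_eq_zero_iff.2 h
    omega
  have hadj : G.Adj x P.penultimate := (P.adj_penultimate hnil).symm
  refine ⟨P.penultimate, ⟨hadj, ?_⟩, key⟩
  have h1 : G.dist o P.penultimate ≤ k := by
    have := SimpleGraph.dist_le P.dropLast
    have h3 : P.dropLast.length = P.length - 1 := by simp
    omega
  rcases ht.dist_eq_dist_add_one_of_adj o hadj with h | h <;> omega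


lemma nb_exists {V : Type*} (G : SimpleGraph V) (N : ℕ) (hN : 2 ≤ N)
    (hreg : ∀ v, (G.neighborSet v).ncard = N)
    (x : V) : ∃ s : Finset V, (∀ y, y ∈ s ↔ G.Adj x y) ∧ s.card = N := by
  have hf : (G.neighborSet x).Finite := Set.finite_of_ncard_ne_zero (by rw [hreg]; omega)
  refine ⟨hf.toFinset, by simp, ?_⟩
  rw [← hreg x, Set.ncard_eq_toFinset_card _ hf]

lemma ch_exists {V : Type*} (G : SimpleGraph V) (N : ℕ) (hN : 2 ≤ N)
    (htree : G.IsTree) (hreg : ∀ v, (G.neighborSet v).ncard = N) (o : V)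
    (x : V) (k : ℕ) (hx : G.dist o x = k + 1) :
    ∃ (y : V) (s : Finset V), G.Adj x y ∧ G.dist o y = k ∧ y ∉ s ∧
     (∀ z, z ∈ s ↔ (G.Adj x z ∧ G.dist o z = k + 2)) ∧
     (∀ z, G.Adj x z → z ≠ y → z ∈ s) ∧ s.card = N - 1 := by
  classical
  obtain ⟨s, hs, hc⟩ := nb_exists G N hN hreg x
  obtain ⟨y, ⟨hy, hyd⟩, hu⟩ := tree_parent G htree o x k hx
  refine ⟨y, s.erase y, hy, hyd, by simp, ?_, ?_, ?_⟩
  · intro z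
    rw [Finset.mem_erase, hs]
    constructor
    · rintro ⟨h1, h2⟩
      refine ⟨h2, ?_⟩
      rcases htree.dist_eq_dist_add_one_of_adj o h2 with h | h
      · exact absurd (hu z h2 (by omega)) h1
      · omega
    · rintro ⟨h1, h2⟩
      refine ⟨?_, h1⟩
      rintro rfl
      omega
  · intro z hz hne
    simp [hs, hz, hne]
  · rw [Finset.card_erase_of_mem ((hs y).2 hy), hc]

lemma sum_root {V : Type*} (G : SimpleGraph V) (N : ℕ) (hN : 2 ≤ N)
    (hreg : ∀ v, (G.neighborSet v).ncard = N) (o : V)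
    (F : V → ℝ) (A : ℝ) (h0 : ∀ y, ¬ G.Adj o y → F y = 0)
    (hA : ∀ y, G.Adj o y → F y = A) : ∑ᶠ y, F y = N * A := by
  obtain ⟨s, hs, hc⟩ := nb_exists G N hN hreg o
  rw [finsum_eq_sum_of_support_subset F (s := s)]
  · rw [Finset.sum_congr rfl (fun y hy => hA y ((hs y).1 hy))]
    simp [hc]
  · intro y hy
    rw [Function.mem_support] at hy
    by_contra h
    exact hy (h0 y (fun h' => h (by simpa using (hs y).2 h')))

lemma sum_nonroot {V : Type*} (G : SimpleGraph V) (N : ℕ) (hN : 2 ≤ N)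
    (htree : G.IsTree) (hreg : ∀ v, (G.neighborSet v).ncard = N) (o : V)
    (x : V) (k : ℕ) (hx : G.dist o x = k + 1)
    (F : V → ℝ) (A B : ℝ) (h0 : ∀ y, ¬ G.Adj x y → F y = 0)
    (hA : ∀ y, G.Adj x y → G.dist o y = k → F y = A)
    (hB : ∀ y, G.Adj x y → G.dist o y = k + 2 → F y = B) :
    ∑ᶠ y, F y = A + ((N : ℝ) - 1) * B := by
  classical
  obtain ⟨y, s, h1, h2, h3, h4, h5, h6⟩ := ch_exists G N hN htree hreg o x k hx
  rw [finsum_eq_sum_of_support_subset F (s := insert y s)]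
  · rw [Finset.sum_insert h3, hA y h1 h2,
      Finset.sum_congr rfl (fun z hz => hB z ((h4 z).1 hz).1 ((h4 z).1 hz).2)]
    rw [Finset.sum_const, h6, nsmul_eq_mul, Nat.cast_sub (by omega)]
    simp
  · intro z hz
    rw [Function.mem_support] at hz
    by_contra h
    apply hz
    apply h0
    intro hadj
    apply h
    by_cases hzy : z = y
    · simp [hzy]
    · simp [h5 z hadj hzy]

lemma sphere_exists {V : Type*} (G : SimpleGraph V) (N : ℕ) (hN : 2 ≤ N)
    (htree : G.IsTree) (hreg : ∀ v, (G.neighborSet v).ncard = N) (o : V)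
    (k : ℕ) : ∃ s : Finset V, (∀ x, x ∈ s ↔ G.dist o x = k) ∧
    s.card = if k = 0 then 1 else N * (N - 1) ^ (k - 1) := by
  classical
  have h00 : ∀ x, G.dist o x = 0 ↔ x = o := fun x => by
    rw [(htree.connected o x).dist_eq_zero_iff]; exact eq_comm
  rcases k with _ | k
  · exact ⟨{o}, fun x => by rw [h00]; simp, by simp⟩
  induction k with
  | zero =>
    obtain ⟨s, hs, hc⟩ := nb_exists G N hN hreg o
    refine ⟨s, fun x => ?_, by simp [hc]⟩
    rw [hs, zero_add, SimpleGraph.dist_eq_one_iff_adj]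
  | succ k ih =>
    obtain ⟨s, hs, hc⟩ := ih
    have hch : ∀ x, ∃ t : Finset V, G.dist o x = k + 1 →
        ((∀ z, z ∈ t ↔ (G.Adj x z ∧ G.dist o z = k + 2)) ∧ t.card = N - 1) := by
      intro x
      by_cases hx : G.dist o x = k + 1
      · obtain ⟨y, t, h1, h2, h3, h4, h5, h6⟩ := ch_exists G N hN htree hreg o x k hx
        exact ⟨t, fun _ => ⟨h4, h6⟩⟩
      · exact ⟨∅, fun h => absurd h hx⟩
    choose t ht using hch
    refine ⟨s.biUnion t, ?_, ?_⟩
    · intro z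
      rw [Finset.mem_biUnion]
      constructor
      · rintro ⟨x, hx, hz⟩
        exact (((ht x ((hs x).1 hx)).1 z).1 hz).2
      · intro hz
        obtain ⟨y, ⟨hy, hyd⟩, -⟩ := tree_parent G htree o z (k + 1) hz
        exact ⟨y, (hs y).2 hyd, ((ht y hyd).1 z).2 ⟨hy.symm, hz⟩⟩
    · rw [Finset.card_biUnion]
      · rw [Finset.sum_congr rfl (fun x hx => (ht x ((hs x).1 hx)).2)]
        rw [Finset.sum_const, hc]
        simp [pow_succ, mul_assoc]
      · intro a ha b hb hab
        rw [Function.onFun, Finset.disjoint_left]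
        intro z hza hzb
        have h1 := ((ht a ((hs a).1 ha)).1 z).1 hza
        have h2 := ((ht b ((hs b).1 hb)).1 z).1 hzb
        obtain ⟨y, -, hu⟩ := tree_parent G htree o z (k + 1) h1.2
        exact hab ((hu a h1.1.symm ((hs a).1 ha)).trans (hu b h2.1.symm ((hs b).1 hb)).symm)

lemma Wvol_eq {V : Type*} (G : SimpleGraph V) (N : ℕ) (hN : 2 ≤ N)
    (htree : G.IsTree) (hreg : ∀ v, (G.neighborSet v).ncard = N) (o : V)
    (w : ℕ → ℝ) (μ : V → V → ℝ) (hμ0 : ∀ x y, ¬ G.Adj x y → μ x y = 0)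
    (hμ : ∀ x y, G.Adj x y → μ x y =
      w (min (G.dist o x) (G.dist o y)) / (N * ((N : ℝ) - 1) ^ (min (G.dist o x) (G.dist o y))))
    (n : ℕ) : Wvol G μ o n = ∑ k ∈ Finset.range (n + 1), w k := by
  classical
  have hN0 : (N : ℝ) ≠ 0 := by positivity
  have hN1 : (N : ℝ) - 1 ≠ 0 := by
    have : (2 : ℝ) ≤ N := by exact_mod_cast hN
    linarith
  have h00 : ∀ x, G.dist o x = 0 ↔ x = o := fun x => by
    rw [(htree.connected o x).dist_eq_zero_iff]; exact eq_comm
  have hinner : ∀ x, (∑ᶠ y, if G.dist o x ≤ n ∧ G.dist o x < G.dist o y then μ x y else 0)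
      = if G.dist o x ≤ n then
        (if G.dist o x = 0 then w 0 else
          w (G.dist o x) / (N * ((N : ℝ) - 1) ^ (G.dist o x - 1))) else 0 := by
    intro x
    by_cases hxn : G.dist o x ≤ n
    swap
    · simp [hxn]
    rcases hk : G.dist o x with _ | k
    · obtain rfl := (h00 x).1 hk
      rw [sum_root G N hN hreg x _ (w 0 / N)]
      · simp; field_simp
      · intro y hy; rw [hμ0 x y hy]; simp
      · intro y hy
        have := SimpleGraph.dist_eq_one_iff_adj.2 hy
        simp [this, hμ x y hy]
    · rw [sum_nonroot G N hN htree hreg o x k hk _ 0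
        (w (k + 1) / (N * ((N : ℝ) - 1) ^ (k + 1)))]
      · rw [hk] at hxn
        simp [hxn, pow_succ]; field_simp
      · intro y hy; rw [hμ0 x y hy]; simp
      · intro y hy hd
        simp [hd]
      · intro y hy hd
        rw [hk] at hxn
        rw [if_pos ⟨hxn, by omega⟩, hμ x y hy, hk, hd]
        simp
  unfold Wvol
  rw [finsum_congr (fun x => by convert hinner x)]
  choose S hS hSc using sphere_exists G N hN htree hreg o
  rw [finsum_eq_sum_of_support_subset _ (s := (Finset.range (n + 1)).biUnion S)]
  · rw [Finset.sum_biUnion]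
    · apply Finset.sum_congr rfl
      intro k hk
      rw [Finset.sum_congr rfl (g := fun _ => if k = 0 then w 0 else
          w k / (N * ((N : ℝ) - 1) ^ (k - 1)))]
      · rw [Finset.sum_const, hSc, nsmul_eq_mul]
        rcases k with _ | k
        · simp
        · simp only [Nat.add_eq_zero_iff, one_ne_zero, and_false, if_false]
          push_cast [Nat.cast_sub (show 1 ≤ N by omega)]
          have : (N * ((N : ℝ) - 1) ^ (k + 1 - 1)) ≠ 0 := by positivity
          field_simp
      · intro x hx
        rw [hS] at hx
        rw [hx, if_pos (by simpa [Nat.lt_succ_iff] using hk)]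
    · intro a _ b _ hab
      rw [Function.onFun, Finset.disjoint_left]
      intro x h1 h2
      rw [hS] at h1 h2
      exact hab (h1.symm.trans h2)
  · intro x hx
    rw [Function.mem_support] at hx
    simp only [Finset.coe_biUnion, Set.mem_iUnion, Finset.mem_coe, Finset.mem_range]
    refine ⟨G.dist o x, ?_, (hS _ x).2 rfl⟩
    by_contra h
    exact hx (if_neg (by omega))

lemma an_logpos (k : ℕ) : 0 < Real.log ((k : ℝ) + 2) :=
  Real.log_pos (by have : (0 : ℝ) ≤ k := by positivity
                   linarith)

lemma an_bern (s x : ℝ) (hs : 0 < s) (hx : 1 < x) :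
    s * x ^ (-(s + 1)) ≤ (x - 1) ^ (-s) - x ^ (-s) := by
  have hx0 : 0 < x := by linarith
  have hr : 0 < 1 - 1 / x := by
    rw [sub_pos, div_lt_one hx0]; exact hx
  have h1 : (x - 1) ^ (-s) = x ^ (-s) * (1 - 1 / x) ^ (-s) := by
    rw [← Real.mul_rpow hx0.le hr.le]; congr 1; field_simp
  have h2 : x ^ (-(s + 1)) = x ^ (-s) * (1 / x) := by
    rw [neg_add, Real.rpow_add hx0, Real.rpow_neg_one, one_div]
  have h3 : 1 + s * (1 / x) ≤ (1 - 1 / x) ^ (-s) := by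
    rw [Real.rpow_def_of_pos hr]
    have h4 := Real.add_one_le_exp (Real.log (1 - 1 / x) * -s)
    have h5 := Real.log_le_sub_one_of_pos hr
    nlinarith
  have h6 : 0 < x ^ (-s) := Real.rpow_pos_of_pos hx0 _
  rw [h1, h2]
  nlinarith [mul_le_mul_of_nonneg_left h3 h6.le]

lemma an_tail (s t : ℝ) (hs : 0 < s) (ht : 0 < t) (k J : ℕ) :
    ∑ j ∈ Finset.range J, (((k + j : ℕ) : ℝ) + 2) ^ (-(s + 1)) *
        Real.log (((k + j : ℕ) : ℝ) + 2) ^ (-t)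
      ≤ (2 ^ s / s) * (((k : ℝ) + 2) ^ (-s) * Real.log ((k : ℝ) + 2) ^ (-t)) := by
  have hL := an_logpos k
  have hk : (0 : ℝ) ≤ k := by positivity
  have hLt : 0 < Real.log ((k : ℝ) + 2) ^ (-t) := Real.rpow_pos_of_pos hL _
  have hterm : ∀ j : ℕ, (((k + j : ℕ) : ℝ) + 2) ^ (-(s + 1)) *
        Real.log (((k + j : ℕ) : ℝ) + 2) ^ (-t) ≤
      (Real.log ((k : ℝ) + 2) ^ (-t) / s) * (((k : ℝ) + j + 1) ^ (-s)
        - ((k : ℝ) + (j + 1 : ℕ) + 1) ^ (-s)) := by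
    intro j
    have hj : (0 : ℝ) ≤ j := by positivity
    have h1 := an_bern s ((k : ℝ) + j + 2) hs (by linarith)
    have h2 : Real.log ((k : ℝ) + j + 2) ^ (-t) ≤ Real.log ((k : ℝ) + 2) ^ (-t) :=
      Real.rpow_le_rpow_of_nonpos hL (Real.log_le_log (by linarith) (by linarith)) (by linarith)
    have h3 : (0 : ℝ) < ((k : ℝ) + j + 2) ^ (-(s + 1)) := Real.rpow_pos_of_pos (by linarith) _
    push_cast
    rw [show (k : ℝ) + j + 2 - 1 = k + j + 1 by ring] at h1
    rw [show (k : ℝ) + (j + 1) + 1 = k + j + 2 by ring]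
    calc _ ≤ ((k : ℝ) + j + 2) ^ (-(s + 1)) * Real.log ((k : ℝ) + 2) ^ (-t) := by gcongr
      _ = (Real.log ((k : ℝ) + 2) ^ (-t) / s) * (s * ((k : ℝ) + j + 2) ^ (-(s + 1))) := by
        field_simp
      _ ≤ _ := by gcongr
  refine (Finset.sum_le_sum (fun j _ => hterm j)).trans ?_
  rw [← Finset.mul_sum, Finset.sum_range_sub' (fun j : ℕ => ((k : ℝ) + j + 1) ^ (-s))]
  have h7 : (0 : ℝ) ≤ ((k : ℝ) + J + 1) ^ (-s) := by positivity
  have h8 : ((k : ℝ) + 1) ^ (-s) ≤ 2 ^ s * ((k : ℝ) + 2) ^ (-s) := by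
    have : (2 : ℝ) ^ s * ((k : ℝ) + 2) ^ (-s) = (((k : ℝ) + 2) / 2) ^ (-s) := by
      rw [Real.div_rpow (by linarith) (by norm_num), Real.rpow_neg (by norm_num : (0:ℝ) ≤ 2) s]
      field_simp
    rw [this]
    exact Real.rpow_le_rpow_of_nonpos (by linarith) (by linarith) (by linarith)
  calc _ ≤ (Real.log ((k : ℝ) + 2) ^ (-t) / s) * (2 ^ s * ((k : ℝ) + 2) ^ (-s)) := by
        gcongr
        push_cast
        rw [add_zero]
        linarith
    _ = _ := by ring

lemma an_f (s t : ℝ) (hs : 0 < s) (ht : 0 < t) (g : ℕ → ℝ)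
    (hg : ∀ k : ℕ, g k = ((k : ℝ) + 2) ^ (-(s + 1)) * Real.log ((k : ℝ) + 2) ^ (-t)) :
    ∃ f : ℕ → ℝ, (∀ k, 0 < f k) ∧ (∀ k, f k - f (k + 1) = g k) ∧
      ∀ k : ℕ, f k ≤ (2 ^ s / s) * (((k : ℝ) + 2) ^ (-s) * Real.log ((k : ℝ) + 2) ^ (-t)) := by
  have hgp : ∀ k, 0 < g k := fun k => by
    rw [hg]
    have := an_logpos k
    positivity
  have htail := an_tail s t hs ht
  have hsum : ∀ k, Summable (fun j => g (k + j)) := by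
    intro k
    apply summable_of_sum_range_le (fun j => (hgp _).le)
    intro J
    simp only [hg]
    exact htail k J
  refine ⟨fun k => ∑' j, g (k + j), ?_, ?_, ?_⟩
  · intro k
    exact (hsum k).tsum_pos (fun j => (hgp _).le) 0 (hgp _)
  · intro k
    have := (hsum k).tsum_eq_zero_add
    simp only [add_zero] at this
    simp only [this]
    have h2 : ∀ j, g (k + (j + 1)) = g (k + 1 + j) := fun j => by congr 1; ring
    simp [h2]
  · intro k
    apply Real.tsum_le_of_sum_range_le (fun j => (hgp _).le)
    intro J
    simp only [hg]
    exact htail k J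

lemma an_step (k : ℕ) : ((k + 1 : ℕ) : ℝ) + 2 ≤ 2 * ((k : ℝ) + 2) ∧
    Real.log (((k + 1 : ℕ) : ℝ) + 2) ≤ 2 * Real.log ((k : ℝ) + 2) ∧
    ((k : ℝ) + 2 ≤ ((k + 1 : ℕ) : ℝ) + 2) ∧
    Real.log ((k : ℝ) + 2) ≤ Real.log (((k + 1 : ℕ) : ℝ) + 2) := by
  have hk : (0 : ℝ) ≤ k := by positivity
  push_cast
  refine ⟨by linarith, ?_, by linarith, Real.log_le_log (by linarith) (by linarith)⟩
  have : 2 * Real.log ((k : ℝ) + 2) = Real.log (((k : ℝ) + 2) ^ 2) := by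
    rw [Real.log_pow]; norm_num
  rw [this]
  apply Real.log_le_log (by linarith)
  nlinarith

lemma an_g (s t : ℝ) (hs : 0 < s) (ht : 0 < t) (g : ℕ → ℝ)
    (hg : ∀ k : ℕ, g k = ((k : ℝ) + 2) ^ (-(s + 1)) * Real.log ((k : ℝ) + 2) ^ (-t)) (k : ℕ) :
    g (k + 1) ≤ g k ∧ g k ≤ (2 ^ (s + 1) * 2 ^ t) * g (k + 1) := by
  obtain ⟨h1, h2, h3, h4⟩ := an_step k
  have hL := an_logpos k
  have hL' := an_logpos (k + 1)
  have hk : (0 : ℝ) < (k : ℝ) + 2 := by positivity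
  have hk' : (0 : ℝ) < ((k + 1 : ℕ) : ℝ) + 2 := by positivity
  have aux : ∀ (x y r : ℝ), 0 < x → 0 < y → 0 < r → y ≤ 2 * x → x ^ (-r) ≤ 2 ^ r * y ^ (-r) := by
    intro x y r hx hy hr h
    have : (2 : ℝ) ^ r * y ^ (-r) = (y / 2) ^ (-r) := by
      rw [Real.div_rpow hy.le (by norm_num), Real.rpow_neg (by norm_num : (0:ℝ) ≤ 2) r]
      field_simp
    rw [this]
    exact Real.rpow_le_rpow_of_nonpos (by linarith) (by linarith) (by linarith)
  rw [hg, hg]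
  constructor
  · apply mul_le_mul
    · exact Real.rpow_le_rpow_of_nonpos hk h3 (by linarith)
    · exact Real.rpow_le_rpow_of_nonpos hL h4 (by linarith)
    · positivity
    · positivity
  · calc _ ≤ (2 ^ (s + 1) * (((k + 1 : ℕ) : ℝ) + 2) ^ (-(s + 1))) *
          (2 ^ t * Real.log (((k + 1 : ℕ) : ℝ) + 2) ^ (-t)) := by
          apply mul_le_mul
          · exact aux _ _ _ hk hk' (by linarith) h1
          · exact aux _ _ _ hL hL' ht h2
          · positivity
          · positivity
      _ = _ := by ring

lemma an_inc (ε : ℝ) (hε : 0 < ε) (k : ℕ) :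
    min 1 ε * ((((k + 1 : ℕ) : ℝ) + 2) ^ (-1 : ℝ) * Real.log (((k + 1 : ℕ) : ℝ) + 2) ^ (ε - 1)) ≤
    Real.log (((k + 1 : ℕ) : ℝ) + 2) ^ ε - Real.log ((k : ℝ) + 2) ^ ε := by
  have hy := an_logpos k
  have hx := an_logpos (k + 1)
  obtain ⟨-, -, -, h4⟩ := an_step k
  have hk : (0 : ℝ) < (k : ℝ) + 2 := by positivity
  have hk' : (0 : ℝ) < ((k + 1 : ℕ) : ℝ) + 2 := by positivity
  have hd : (((k + 1 : ℕ) : ℝ) + 2) ^ (-1 : ℝ) ≤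
      Real.log (((k + 1 : ℕ) : ℝ) + 2) - Real.log ((k : ℝ) + 2) := by
    rw [← Real.log_div hk'.ne' hk.ne', Real.rpow_neg_one]
    have := Real.one_sub_inv_le_log_of_pos (div_pos hk' hk)
    refine le_trans (le_of_eq ?_) this
    push_cast at hk' ⊢
    have h9 : (k : ℝ) + 1 + 2 ≠ 0 := hk'.ne'
    field_simp
    ring
  set x := Real.log (((k + 1 : ℕ) : ℝ) + 2)
  set y := Real.log ((k : ℝ) + 2)
  set X := (((k + 1 : ℕ) : ℝ) + 2) ^ (-1 : ℝ)
  have hX : 0 < X := Real.rpow_pos_of_pos hk' _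
  have hr0 : 0 < y / x := div_pos hy hx
  have hr1 : y / x ≤ 1 := (div_le_one hx).2 h4
  have hc : 0 < min 1 ε := lt_min one_pos hε
  have key : (y / x) ^ ε ≤ 1 - min 1 ε * (1 - y / x) := by
    rcases le_total 1 ε with h | h
    · rw [min_eq_left h]
      have := Real.rpow_le_rpow_of_exponent_ge hr0 hr1 h
      rw [Real.rpow_one] at this
      linarith
    · rw [min_eq_right h]
      have := rpow_one_add_le_one_add_mul_self (s := y / x - 1) (by linarith) hε.le h
      rw [show 1 + (y / x - 1) = y / x by ring] at this
      linarith
  have e1 : y ^ ε = x ^ ε * (y / x) ^ ε := by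
    rw [← Real.mul_rpow hx.le hr0.le]; congr 1; field_simp
  have hxe : 0 < x ^ (ε - 1) := Real.rpow_pos_of_pos hx _
  have e2 : x ^ ε = x ^ (ε - 1) * x := by
    rw [Real.rpow_sub_one hx.ne']; field_simp
  have hxx : 0 < x ^ ε := Real.rpow_pos_of_pos hx _
  calc min 1 ε * (X * x ^ (ε - 1)) ≤ min 1 ε * ((x - y) * x ^ (ε - 1)) := by gcongr
    _ = x ^ ε * (min 1 ε * (1 - y / x)) := by rw [e2]; field_simp
    _ ≤ x ^ ε * (1 - (y / x) ^ ε) := by gcongr; linarith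
    _ = x ^ ε - y ^ ε := by rw [e1]; ring

lemma an_W (a b : ℝ) (ha : 1 < a) (hb : 0 < b) : ∃ c C : ℝ, 0 < c ∧ 0 < C ∧
    ∀ n : ℕ, 2 ≤ n →
      c * ((n : ℝ) ^ a * Real.log n ^ b) ≤
        ∑ k ∈ Finset.range (n + 1), ((k : ℝ) + 2) ^ (a - 1) * Real.log ((k : ℝ) + 2) ^ b ∧
      ∑ k ∈ Finset.range (n + 1), ((k : ℝ) + 2) ^ (a - 1) * Real.log ((k : ℝ) + 2) ^ b ≤
        C * ((n : ℝ) ^ a * Real.log n ^ b) := by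
  refine ⟨(1 / 2) ^ a * (1 / 2) ^ b, 2 ^ a * 2 ^ b, by positivity, by positivity, ?_⟩
  intro n hn
  have hn' : (2 : ℝ) ≤ n := by exact_mod_cast hn
  have hn0 : (0 : ℝ) < n := by linarith
  have hLn : 0 < Real.log n := Real.log_pos (by linarith)
  have hsplit : ∀ x : ℝ, 0 < x → x ^ a = x * x ^ (a - 1) := by
    intro x hx
    rw [Real.rpow_sub_one hx.ne']; field_simp
  constructor
  · have hterm : ∀ k ∈ Finset.Ico (n / 2) (n + 1),
        ((n : ℝ) / 2) ^ (a - 1) * (Real.log n / 2) ^ b ≤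
        ((k : ℝ) + 2) ^ (a - 1) * Real.log ((k : ℝ) + 2) ^ b := by
      intro k hk
      rw [Finset.mem_Ico] at hk
      have h1 : n ≤ 2 * k + 1 := by omega
      have h1' : (n : ℝ) ≤ 2 * k + 1 := by exact_mod_cast h1
      have hL := an_logpos k
      have h2 : Real.log n / 2 ≤ Real.log ((k : ℝ) + 2) := by
        have : 2 * Real.log ((k : ℝ) + 2) = Real.log (((k : ℝ) + 2) ^ 2) := by
          rw [Real.log_pow]; norm_num
        have h3 : Real.log n ≤ Real.log (((k : ℝ) + 2) ^ 2) :=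
          Real.log_le_log hn0 (by nlinarith)
        linarith
      apply mul_le_mul
      · exact Real.rpow_le_rpow (by positivity) (by linarith) (by linarith)
      · exact Real.rpow_le_rpow (by positivity) h2 hb.le
      · positivity
      · positivity
    have hcard := Finset.card_nsmul_le_sum _ _ _ hterm
    rw [Nat.card_Ico, nsmul_eq_mul] at hcard
    have hsub : ∑ k ∈ Finset.Ico (n / 2) (n + 1),
          ((k : ℝ) + 2) ^ (a - 1) * Real.log ((k : ℝ) + 2) ^ b ≤
        ∑ k ∈ Finset.range (n + 1), ((k : ℝ) + 2) ^ (a - 1) * Real.log ((k : ℝ) + 2) ^ b := by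
      apply Finset.sum_le_sum_of_subset_of_nonneg
      · intro k hk
        rw [Finset.mem_Ico] at hk
        exact Finset.mem_range.2 hk.2
      · intro k _ _
        have hL := an_logpos k
        positivity
    refine le_trans ?_ (hcard.trans hsub)
    have hc2 : (n : ℝ) / 2 ≤ ((n + 1 - n / 2 : ℕ) : ℝ) := by
      have : n ≤ 2 * (n + 1 - n / 2) := by omega
      have : (n : ℝ) ≤ 2 * ((n + 1 - n / 2 : ℕ) : ℝ) := by exact_mod_cast this
      linarith
    calc _ = ((n : ℝ) / 2) ^ a * (Real.log n / 2) ^ b := by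
          rw [show (n : ℝ) / 2 = 1 / 2 * n by ring, show Real.log n / 2 = 1 / 2 * Real.log n by ring,
            Real.mul_rpow (by norm_num) hn0.le, Real.mul_rpow (by norm_num) hLn.le]
          ring
      _ = (n : ℝ) / 2 * (((n : ℝ) / 2) ^ (a - 1) * (Real.log n / 2) ^ b) := by
          rw [hsplit _ (by positivity)]; ring
      _ ≤ _ := by gcongr
  · have hterm : ∀ k ∈ Finset.range (n + 1),
        ((k : ℝ) + 2) ^ (a - 1) * Real.log ((k : ℝ) + 2) ^ b ≤
        (2 * (n : ℝ)) ^ (a - 1) * (2 * Real.log n) ^ b := by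
      intro k hk
      rw [Finset.mem_range] at hk
      have h1 : (k : ℝ) ≤ n := by exact_mod_cast Nat.lt_succ_iff.1 hk
      have hL := an_logpos k
      have h2 : Real.log ((k : ℝ) + 2) ≤ 2 * Real.log n := by
        have : 2 * Real.log (n : ℝ) = Real.log ((n : ℝ) ^ 2) := by
          rw [Real.log_pow]; norm_num
        rw [this]
        exact Real.log_le_log (by positivity) (by nlinarith)
      apply mul_le_mul
      · exact Real.rpow_le_rpow (by positivity) (by linarith) (by linarith)
      · exact Real.rpow_le_rpow (by positivity) h2 hb.le
      · positivity
      · positivity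
    have hcard := Finset.sum_le_card_nsmul _ _ _ hterm
    rw [Finset.card_range, nsmul_eq_mul] at hcard
    refine hcard.trans ?_
    calc _ ≤ (2 * (n : ℝ)) * ((2 * (n : ℝ)) ^ (a - 1) * (2 * Real.log n) ^ b) := by
          gcongr
          push_cast
          linarith
      _ = (2 * (n : ℝ)) ^ a * (2 * Real.log n) ^ b := by
          rw [hsplit (2 * (n : ℝ)) (by positivity)]; ring
      _ = _ := by
          rw [Real.mul_rpow (by norm_num) hn0.le, Real.mul_rpow (by norm_num) hLn.le]
          ring

set_option maxHeartbeats 2000000 in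
lemma an_unscaled (m p q ε : ℝ) (hm : 1 < m) (hp : 0 ≤ p) (hq1 : m - 1 - p < q) (hq2 : q < m)
    (hε : 0 < ε) :
    ∃ w g f : ℕ → ℝ, (∀ k, 0 < w k) ∧ (∀ k, 0 < g k) ∧ (∀ k, 0 < f k) ∧
      (∀ k, f k - f (k + 1) = g k) ∧
      (∃ K : ℝ, 0 < K ∧ f 0 ^ p * Real.sqrt (g 0 ^ 2 / 2) ^ q ≤ K * g 0 ^ (m - 1) ∧
        ∀ k, (w k + w (k + 1)) * (f (k + 1) ^ p *
          Real.sqrt ((w k * g k ^ 2 + w (k + 1) * g (k + 1) ^ 2) / (2 * (w k + w (k + 1)))) ^ q) ≤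
          K * (w (k + 1) * g (k + 1) ^ (m - 1) - w k * g k ^ (m - 1))) ∧
      ∃ c C : ℝ, 0 < c ∧ 0 < C ∧ ∀ n : ℕ, 2 ≤ n →
          c * ((n : ℝ) ^ ((m * p + q) / (p + q - m + 1)) *
              (Real.log n) ^ ((m - 1) / (p + q - m + 1) + ε)) ≤ ∑ k ∈ Finset.range (n + 1), w k ∧
          ∑ k ∈ Finset.range (n + 1), w k ≤
            C * ((n : ℝ) ^ ((m * p + q) / (p + q - m + 1)) *
              (Real.log n) ^ ((m - 1) / (p + q - m + 1) + ε)) := by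
  obtain ⟨D, hDdef⟩ : ∃ D, D = p + q - m + 1 := ⟨_, rfl⟩
  have hD : 0 < D := by linarith
  rw [← hDdef]
  obtain ⟨s, hsdef⟩ : ∃ s, s = (m - q) / D := ⟨_, rfl⟩
  obtain ⟨t, htdef⟩ : ∃ t, t = 1 / D := ⟨_, rfl⟩
  obtain ⟨a, hadef⟩ : ∃ a, a = (m * p + q) / D := ⟨_, rfl⟩
  obtain ⟨b, hbdef⟩ : ∃ b, b = (m - 1) / D + ε := ⟨_, rfl⟩
  have hs : 0 < s := by rw [hsdef]; exact div_pos (by linarith) hD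
  have ht : 0 < t := by rw [htdef]; positivity
  have hb : 0 < b := by
    rw [hbdef]
    have : 0 < (m - 1) / D := div_pos (by linarith) hD
    linarith
  have hsD : s * D = m - q := by rw [hsdef]; field_simp
  have htD : t * D = 1 := by rw [htdef]; field_simp
  have hbt : b = (m - 1) * t + ε := by rw [hbdef, htdef]; ring
  have hae : a - 1 = (s + 1) * (m - 1) := by
    rw [hadef, hsdef]; field_simp; rw [hDdef]; ring
  have ha : 1 < a := by
    have : 0 < (s + 1) * (m - 1) := mul_pos (by linarith) (by linarith)
    linarith
  rw [← hadef, ← hbdef]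
  obtain ⟨g, hg⟩ : ∃ g : ℕ → ℝ, ∀ k : ℕ,
    g k = ((k : ℝ) + 2) ^ (-(s + 1)) * Real.log ((k : ℝ) + 2) ^ (-t) := ⟨_, fun _ => rfl⟩
  obtain ⟨w, hw⟩ : ∃ w : ℕ → ℝ, ∀ k : ℕ,
    w k = ((k : ℝ) + 2) ^ (a - 1) * Real.log ((k : ℝ) + 2) ^ b := ⟨_, fun _ => rfl⟩
  have hgp : ∀ k, 0 < g k := fun k => by
    rw [hg]; have := an_logpos k; positivity
  have hwp : ∀ k, 0 < w k := fun k => by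
    rw [hw]; have := an_logpos k; positivity
  obtain ⟨f, hf, hfg, hfb⟩ := an_f s t hs ht g hg
  have hgg := an_g s t hs ht g hg
  have hinc := an_inc ε hε
  obtain ⟨c, C, hc, hC, hW⟩ := an_W a b ha hb
  refine ⟨w, g, f, hwp, hgp, hf, hfg, ?_, c, C, hc, hC, ?_⟩
  swap
  · intro n hn
    simp only [hw]
    exact hW n hn
  obtain ⟨C1, hC1def⟩ : ∃ C1 : ℝ, C1 = 2 ^ s / s := ⟨_, rfl⟩
  obtain ⟨C2, hC2def⟩ : ∃ C2 : ℝ, C2 = 2 ^ (s + 1) * 2 ^ t := ⟨_, rfl⟩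
  have hC1 : 0 < C1 := by rw [hC1def]; positivity
  have hC2 : 0 < C2 := by rw [hC2def]; positivity
  rw [← hC1def] at hfb
  rw [← hC2def] at hgg
  obtain ⟨C3, hC3def⟩ : ∃ C3 : ℝ, C3 = (1 / 2) ^ q + C2 ^ q := ⟨_, rfl⟩
  have hC3 : 0 < C3 := by rw [hC3def]; positivity
  have hmin : 0 < min 1 ε := lt_min one_pos hε
  obtain ⟨A0, hA0⟩ : ∃ A0 : ℝ, A0 = f 0 ^ p * Real.sqrt (g 0 ^ 2 / 2) ^ q / g 0 ^ (m - 1) :=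
    ⟨_, rfl⟩
  obtain ⟨A1, hA1⟩ : ∃ A1 : ℝ, A1 = 2 * C1 ^ p * C3 / min 1 ε := ⟨_, rfl⟩
  have hg0 := hgp 0
  have hf0 := hf 0
  have hA0p : 0 < A0 := by rw [hA0]; positivity
  have hA1p : 0 < A1 := by rw [hA1]; positivity
  refine ⟨A0 + A1, by positivity, ?_, ?_⟩
  · have : 0 < g 0 ^ (m - 1) := by positivity
    have h1 : f 0 ^ p * Real.sqrt (g 0 ^ 2 / 2) ^ q = A0 * g 0 ^ (m - 1) := by
      rw [hA0]; field_simp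
    rw [h1]
    gcongr
    linarith
  intro k
  have hwg : ∀ k, w k * g k ^ (m - 1) = Real.log ((k : ℝ) + 2) ^ ε := by
    intro k
    have hL := an_logpos k
    have hk : (0 : ℝ) < (k : ℝ) + 2 := by positivity
    rw [hw, hg, Real.mul_rpow (by positivity) (by positivity), ← Real.rpow_mul hk.le,
      ← Real.rpow_mul hL.le]
    calc _ = (((k : ℝ) + 2) ^ (a - 1) * ((k : ℝ) + 2) ^ (-(s + 1) * (m - 1))) *
          (Real.log ((k : ℝ) + 2) ^ b * Real.log ((k : ℝ) + 2) ^ (-t * (m - 1))) := by ring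
      _ = _ := by
        rw [← Real.rpow_add hk, ← Real.rpow_add hL]
        rw [show a - 1 + -(s + 1) * (m - 1) = 0 by rw [hae]; ring,
          show b + -t * (m - 1) = ε by rw [hbt]; ring]
        simp
  have hww : w k ≤ w (k + 1) := by
    obtain ⟨-, -, h3, h4⟩ := an_step k
    have hL := an_logpos k
    rw [hw, hw]
    apply mul_le_mul
    · exact Real.rpow_le_rpow (by positivity) h3 (by linarith)
    · exact Real.rpow_le_rpow hL.le h4 hb.le
    · positivity
    · positivity
  have hdiff := hinc k
  rw [← hwg, ← hwg] at hdiff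
  obtain ⟨hg1, hg2⟩ := hgg k
  have hgk := hgp k
  have hgk1 := hgp (k + 1)
  have hwk := hwp k
  have hwk1 := hwp (k + 1)
  obtain ⟨e, he⟩ : ∃ e, e = Real.sqrt ((w k * g k ^ 2 + w (k + 1) * g (k + 1) ^ 2) /
    (2 * (w k + w (k + 1)))) := ⟨_, rfl⟩
  have hC2g : C2 * g (k + 1) ≥ g (k + 1) := hg1.trans hg2
  have he1 : 1 / 2 * g (k + 1) ≤ e := by
    rw [he]
    apply Real.le_sqrt_of_sq_le
    rw [le_div_iff₀ (by positivity)]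
    have h1 : g (k + 1) ^ 2 ≤ g k ^ 2 := by gcongr
    have h2 : 0 ≤ g (k + 1) ^ 2 := by positivity
    nlinarith [mul_le_mul_of_nonneg_left h1 hwk.le, mul_nonneg hwk.le h2, mul_nonneg hwk1.le h2]
  have he2 : e ≤ C2 * g (k + 1) := by
    rw [he]
    apply Real.sqrt_le_iff.2 ⟨by positivity, ?_⟩
    rw [div_le_iff₀ (by positivity)]
    have h1 : g k ^ 2 ≤ (C2 * g (k + 1)) ^ 2 := by gcongr
    have h3 : g (k + 1) ^ 2 ≤ (C2 * g (k + 1)) ^ 2 := by gcongr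
    have h2 : 0 ≤ (C2 * g (k + 1)) ^ 2 := by positivity
    nlinarith [mul_le_mul_of_nonneg_left h1 hwk.le, mul_le_mul_of_nonneg_left h3 hwk1.le,
      mul_nonneg hwk.le h2, mul_nonneg hwk1.le h2]
  have hep : 0 < e := lt_of_lt_of_le (by positivity) he1
  have heq : e ^ q ≤ C3 * g (k + 1) ^ q := by
    rw [hC3def, add_mul, ← Real.mul_rpow (by norm_num) hgk1.le, ← Real.mul_rpow hC2.le hgk1.le]
    rcases le_total 0 q with h | h
    · have h1 := Real.rpow_le_rpow hep.le he2 h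
      have : 0 < (1 / 2 * g (k + 1)) ^ q := by positivity
      linarith
    · have h1 := Real.rpow_le_rpow_of_nonpos (by positivity) he1 h
      have : 0 < (C2 * g (k + 1)) ^ q := by positivity
      linarith
  rw [← he]
  obtain ⟨X, hX⟩ : ∃ X, X = ((k + 1 : ℕ) : ℝ) + 2 := ⟨_, rfl⟩
  have hXp : 0 < X := by rw [hX]; positivity
  have hL : 0 < Real.log X := by rw [hX]; exact an_logpos (k + 1)
  have hfk := hf (k + 1)
  have hfp : f (k + 1) ^ p ≤ C1 ^ p * (X ^ (-s) * Real.log X ^ (-t)) ^ p := by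
    rw [← Real.mul_rpow hC1.le (by positivity)]
    apply Real.rpow_le_rpow hfk.le _ hp
    rw [hX]; exact hfb (k + 1)
  have hexp : w (k + 1) * ((X ^ (-s) * Real.log X ^ (-t)) ^ p * g (k + 1) ^ q)
      = X ^ (-1 : ℝ) * Real.log X ^ (ε - 1) := by
    rw [hw, hg, ← hX, Real.mul_rpow (by positivity) (by positivity),
      Real.mul_rpow (by positivity) (by positivity),
      ← Real.rpow_mul hXp.le, ← Real.rpow_mul hXp.le, ← Real.rpow_mul hL.le, ← Real.rpow_mul hL.le]
    calc _ = (X ^ (a - 1) * X ^ (-s * p) * X ^ (-(s + 1) * q)) *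
          (Real.log X ^ b * Real.log X ^ (-t * p) * Real.log X ^ (-t * q)) := by ring
      _ = _ := by
        rw [← Real.rpow_add hXp, ← Real.rpow_add hXp, ← Real.rpow_add hL, ← Real.rpow_add hL]
        congr 2
        · rw [hae]; rw [hDdef] at hsD; linarith
        · rw [hbt]; rw [hDdef] at htD; linarith
  rw [← hX] at hdiff
  rw [← hexp] at hdiff
  have hE : 0 < w (k + 1) * ((X ^ (-s) * Real.log X ^ (-t)) ^ p * g (k + 1) ^ q) := by positivity
  have hdpos : 0 ≤ w (k + 1) * g (k + 1) ^ (m - 1) - w k * g k ^ (m - 1) :=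
    le_trans (by positivity) hdiff
  calc (w k + w (k + 1)) * (f (k + 1) ^ p * e ^ q)
      ≤ (2 * w (k + 1)) * ((C1 ^ p * (X ^ (-s) * Real.log X ^ (-t)) ^ p) *
          (C3 * g (k + 1) ^ q)) := by
        gcongr
        linarith
    _ = A1 * (min 1 ε * (w (k + 1) * ((X ^ (-s) * Real.log X ^ (-t)) ^ p * g (k + 1) ^ q))) := by
        rw [hA1]; field_simp
    _ ≤ A1 * (w (k + 1) * g (k + 1) ^ (m - 1) - w k * g k ^ (m - 1)) := by gcongr
    _ ≤ _ := by gcongr; linarith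

lemma an_scaled (m p q ε : ℝ) (hm : 1 < m) (hp : 0 ≤ p) (hq1 : m - 1 - p < q) (hq2 : q < m)
    (hε : 0 < ε) :
    ∃ w g f : ℕ → ℝ, (∀ k, 0 < w k) ∧ (∀ k, 0 < g k) ∧ (∀ k, 0 < f k) ∧
      (∀ k, f k - f (k + 1) = g k) ∧
      (f 0 ^ p * Real.sqrt (g 0 ^ 2 / 2) ^ q ≤ g 0 ^ (m - 1) ∧
        ∀ k, (w k + w (k + 1)) * (f (k + 1) ^ p *
          Real.sqrt ((w k * g k ^ 2 + w (k + 1) * g (k + 1) ^ 2) / (2 * (w k + w (k + 1)))) ^ q) ≤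
          w (k + 1) * g (k + 1) ^ (m - 1) - w k * g k ^ (m - 1)) ∧
      ∃ c C : ℝ, 0 < c ∧ 0 < C ∧ ∀ n : ℕ, 2 ≤ n →
          c * ((n : ℝ) ^ ((m * p + q) / (p + q - m + 1)) *
              (Real.log n) ^ ((m - 1) / (p + q - m + 1) + ε)) ≤ ∑ k ∈ Finset.range (n + 1), w k ∧
          ∑ k ∈ Finset.range (n + 1), w k ≤
            C * ((n : ℝ) ^ ((m * p + q) / (p + q - m + 1)) *
              (Real.log n) ^ ((m - 1) / (p + q - m + 1) + ε)) := by
  obtain ⟨w, g, f, hw, hg, hf, hfg, ⟨K, hK, h0, h1⟩, hW⟩ := an_unscaled m p q ε hm hp hq1 hq2 hε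
  have hD : 0 < p + q - m + 1 := by linarith
  obtain ⟨l, hl⟩ : ∃ l : ℝ, l = (1 / K) ^ (1 / (p + q - m + 1)) := ⟨_, rfl⟩
  have hlp : 0 < l := by rw [hl]; positivity
  have hlD : l ^ (p + q - m + 1) = 1 / K := by
    rw [hl, ← Real.rpow_mul (by positivity)]
    rw [one_div_mul_cancel hD.ne', Real.rpow_one]
  have hlK : l ^ p * l ^ q * K = l ^ (m - 1) := by
    rw [← Real.rpow_add hlp, show p + q = (p + q - m + 1) + (m - 1) by ring, Real.rpow_add hlp,
      hlD]
    field_simp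
  refine ⟨w, fun k => l * g k, fun k => l * f k, hw, fun k => mul_pos hlp (hg k),
    fun k => mul_pos hlp (hf k), fun k => by simp only [← hfg k]; ring, ⟨?_, ?_⟩, hW⟩
  · have e1 : Real.sqrt ((l * g 0) ^ 2 / 2) = l * Real.sqrt (g 0 ^ 2 / 2) := by
      rw [mul_pow, mul_div_assoc, Real.sqrt_mul (by positivity), Real.sqrt_sq hlp.le]
    simp only [e1]
    rw [Real.mul_rpow hlp.le (hf 0).le, Real.mul_rpow hlp.le (Real.sqrt_nonneg _),
      Real.mul_rpow hlp.le (hg 0).le]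
    calc _ = l ^ p * l ^ q * (f 0 ^ p * Real.sqrt (g 0 ^ 2 / 2) ^ q) := by ring
      _ ≤ l ^ p * l ^ q * (K * g 0 ^ (m - 1)) := by gcongr
      _ = _ := by rw [← hlK]; ring
  · intro k
    have e1 : Real.sqrt ((w k * (l * g k) ^ 2 + w (k + 1) * (l * g (k + 1)) ^ 2) /
          (2 * (w k + w (k + 1)))) = l * Real.sqrt ((w k * g k ^ 2 + w (k + 1) * g (k + 1) ^ 2) /
          (2 * (w k + w (k + 1)))) := by
      rw [← Real.sqrt_sq hlp.le, ← Real.sqrt_mul (by positivity), Real.sqrt_sq hlp.le]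
      congr 1
      ring
    simp only [e1]
    rw [Real.mul_rpow hlp.le (hf _).le, Real.mul_rpow hlp.le (Real.sqrt_nonneg _),
      Real.mul_rpow hlp.le (hg k).le, Real.mul_rpow hlp.le (hg (k + 1)).le]
    calc _ = l ^ p * l ^ q * ((w k + w (k + 1)) * (f (k + 1) ^ p * Real.sqrt ((w k * g k ^ 2 +
          w (k + 1) * g (k + 1) ^ 2) / (2 * (w k + w (k + 1)))) ^ q)) := by ring
      _ ≤ l ^ p * l ^ q * (K * (w (k + 1) * g (k + 1) ^ (m - 1) - w k * g k ^ (m - 1))) := by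
          gcongr l ^ p * l ^ q * ?_
          exact h1 k
      _ = _ := by rw [← hlK]; ring

theorem statement11
    (V : Type*) (G : SimpleGraph V) (N : ℕ) (hN : 2 ≤ N)
    (htree : G.IsTree) (hreg : ∀ v, (G.neighborSet v).ncard = N)
    (o : V)
    (m p q : ℝ) (hm : 1 < m)
    (hp : 0 ≤ p) (hq1 : m - 1 - p < q) (hq2 : q < m)
    (ε : ℝ) (hε : 0 < ε) :
    ∃ μ : V → V → ℝ,
      (∀ x y, μ x y = μ y x) ∧
      (∀ x y, 0 < μ x y ↔ G.Adj x y) ∧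
      (∀ x y, ¬ G.Adj x y → μ x y = 0) ∧
      ∃ u : V → ℝ,
        (∀ x, 0 < u x) ∧ (∃ x y, u x ≠ u y) ∧
        (∀ x, q < 0 → 0 < gradNorm μ u x) ∧
        (∀ x, lapM μ m u x + u x ^ p * gradNorm μ u x ^ q ≤ 0) ∧
        ∃ c C : ℝ, 0 < c ∧ 0 < C ∧ ∀ n : ℕ, 2 ≤ n →
          c * ((n : ℝ) ^ ((m * p + q) / (p + q - m + 1)) *
              (Real.log n) ^ ((m - 1) / (p + q - m + 1) + ε)) ≤ Wvol G μ o n ∧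
          Wvol G μ o n ≤
            C * ((n : ℝ) ^ ((m * p + q) / (p + q - m + 1)) *
              (Real.log n) ^ ((m - 1) / (p + q - m + 1) + ε)) := by
  classical
  obtain ⟨w, g, f, hw, hg, hf, hfg, ⟨hr, hk⟩, hW⟩ := an_scaled m p q ε hm hp hq1 hq2 hε
  have hNp : (0 : ℝ) < N := by positivity
  have hN1 : (0 : ℝ) < (N : ℝ) - 1 := by
    have : (2 : ℝ) ≤ N := by exact_mod_cast hN
    linarith
  obtain ⟨μ, hμ⟩ : ∃ μ : V → V → ℝ, ∀ x y, μ x y = if G.Adj x y then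
      w (min (G.dist o x) (G.dist o y)) / (N * ((N : ℝ) - 1) ^ (min (G.dist o x) (G.dist o y)))
      else 0 := ⟨_, fun _ _ => rfl⟩
  have hμ0 : ∀ x y, ¬ G.Adj x y → μ x y = 0 := fun x y h => by rw [hμ, if_neg h]
  have hμ1 : ∀ x y, G.Adj x y → μ x y =
      w (min (G.dist o x) (G.dist o y)) / (N * ((N : ℝ) - 1) ^ (min (G.dist o x) (G.dist o y))) :=
    fun x y h => by rw [hμ, if_pos h]
  obtain ⟨u, hu⟩ : ∃ u : V → ℝ, ∀ x, u x = f (G.dist o x) := ⟨_, fun _ => rfl⟩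
  have hpow : ∀ x : ℝ, 0 < x → x ^ (m - 2) * x = x ^ (m - 1) := by
    intro x hx
    rw [show m - 1 = (m - 2) + 1 by ring, Real.rpow_add_one hx.ne']
  have h00 : ∀ x, G.dist o x = 0 ↔ x = o := fun x => by
    rw [(htree.connected o x).dist_eq_zero_iff]; exact eq_comm
  -- values at the root
  have hroot_up : ∀ y, G.Adj o y → u y - u o = -g 0 := by
    intro y hy
    have h1 := SimpleGraph.dist_eq_one_iff_adj.2 hy
    rw [hu, hu, h1, SimpleGraph.dist_self, ← hfg 0]; ring
  have hroot_mu : ∀ y, G.Adj o y → μ o y = w 0 / N := by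
    intro y hy
    rw [hμ1 o y hy, SimpleGraph.dist_self]; simp
  have hw0 := hw 0
  have hg0 := hg 0
  have hvM0 : vMeasure μ o = w 0 := by
    unfold vMeasure
    rw [sum_root G N hN hreg o _ (w 0 / N) (hμ0 o) hroot_mu]
    field_simp
  have hgrad0 : gradNorm μ u o = Real.sqrt (g 0 ^ 2 / 2) := by
    unfold gradNorm
    rw [hvM0, sum_root G N hN hreg o _ (w 0 / N / (2 * w 0) * (g 0) ^ 2)]
    · congr 1; field_simp
    · intro y hy; rw [hμ0 o y hy]; simp
    · intro y hy; rw [hroot_mu y hy, hroot_up y hy]; simp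
  have hlap0 : lapM μ m u o = -g 0 ^ (m - 1) := by
    unfold lapM
    rw [hvM0, sum_root G N hN hreg o _ (-(w 0 / N * g 0 ^ (m - 1)))]
    · field_simp
    · intro y hy; rw [hμ0 o y hy]; simp
    · intro y hy
      rw [hroot_mu y hy, hroot_up y hy, abs_neg, abs_of_pos hg0, ← hpow _ hg0]; ring
  -- values elsewhere
  have hother : ∀ (x : V) (k : ℕ), G.dist o x = k + 1 →
      gradNorm μ u x = Real.sqrt ((w k * g k ^ 2 + w (k + 1) * g (k + 1) ^ 2) /
        (2 * (w k + w (k + 1)))) ∧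
      lapM μ m u x = (w k * g k ^ (m - 1) - w (k + 1) * g (k + 1) ^ (m - 1)) /
        (w k + w (k + 1)) := by
    intro x k hx
    obtain ⟨κ, hκ⟩ : ∃ κ : ℝ, κ = 1 / (N * ((N : ℝ) - 1) ^ k) := ⟨_, rfl⟩
    have hκp : 0 < κ := by rw [hκ]; positivity
    have hwk := hw k
    have hwk1 := hw (k + 1)
    have m1 : ∀ y, G.Adj x y → G.dist o y = k → μ x y = κ * w k := by
      intro y hy hd
      rw [hμ1 x y hy, hx, hd, min_eq_right (by omega), hκ]; ring
    have m2 : ∀ y, G.Adj x y → G.dist o y = k + 2 → μ x y = κ * w (k + 1) / ((N : ℝ) - 1) := by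
      intro y hy hd
      rw [hμ1 x y hy, hx, hd, min_eq_left (by omega), hκ, pow_succ]; field_simp
    have u1 : ∀ y, G.dist o y = k → u y - u x = g k := by
      intro y hd
      rw [hu, hu, hx, hd, hfg]
    have u2 : ∀ y, G.dist o y = k + 2 → u y - u x = -g (k + 1) := by
      intro y hd
      rw [hu, hu, hx, hd, ← hfg]; ring
    have hvM : vMeasure μ x = κ * (w k + w (k + 1)) := by
      unfold vMeasure
      rw [sum_nonroot G N hN htree hreg o x k hx _ (κ * w k) (κ * w (k + 1) / ((N : ℝ) - 1))
        (hμ0 x) m1 m2]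
      field_simp
    constructor
    · unfold gradNorm
      rw [hvM, sum_nonroot G N hN htree hreg o x k hx _
        (κ * w k / (2 * (κ * (w k + w (k + 1)))) * g k ^ 2)
        (κ * w (k + 1) / ((N : ℝ) - 1) / (2 * (κ * (w k + w (k + 1)))) * g (k + 1) ^ 2)]
      · congr 1; field_simp
      · intro y hy; rw [hμ0 x y hy]; simp
      · intro y hy hd; rw [m1 y hy hd, u1 y hd]
      · intro y hy hd; rw [m2 y hy hd, u2 y hd]; simp
    · unfold lapM
      rw [hvM, sum_nonroot G N hN htree hreg o x k hx _
        (κ * w k * g k ^ (m - 1))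
        (-(κ * w (k + 1) / ((N : ℝ) - 1) * g (k + 1) ^ (m - 1)))]
      · field_simp; ring
      · intro y hy; rw [hμ0 x y hy]; simp
      · intro y hy hd
        rw [m1 y hy hd, u1 y hd, abs_of_pos (hg k), ← hpow _ (hg k)]; ring
      · intro y hy hd
        rw [m2 y hy hd, u2 y hd, abs_neg, abs_of_pos (hg _), ← hpow _ (hg _)]; ring
  refine ⟨μ, ?_, ?_, hμ0, u, ?_, ?_, ?_, ?_, ?_⟩
  · intro x y
    rw [hμ, hμ, min_comm, G.adj_comm]
  · intro x y
    constructor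
    · intro h
      by_contra h'
      rw [hμ0 x y h'] at h
      exact lt_irrefl _ h
    · intro h
      rw [hμ1 x y h]
      have := hw (min (G.dist o x) (G.dist o y))
      positivity
  · intro x; rw [hu]; exact hf _
  · obtain ⟨s, hs, hc⟩ := nb_exists G N hN hreg o
    obtain ⟨y, hy⟩ : s.Nonempty := Finset.card_pos.1 (by omega)
    refine ⟨y, o, fun h => ?_⟩
    have := hroot_up y ((hs y).1 hy)
    rw [h] at this
    linarith
  · intro x _
    rcases hx : G.dist o x with _ | k
    · rw [(h00 x).1 hx, hgrad0]; positivity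
    · rw [(hother x k hx).1]
      have := hw k
      have := hw (k + 1)
      have := hg k
      have := hg (k + 1)
      positivity
  · intro x
    rcases hx : G.dist o x with _ | k
    · rw [(h00 x).1 hx, hgrad0, hlap0, hu, SimpleGraph.dist_self]; linarith
    · obtain ⟨h1, h2⟩ := hother x k hx
      rw [h1, h2, hu, hx]
      have hwk := hw k
      have hwk1 := hw (k + 1)
      have := hk k
      rw [mul_comm, ← le_div_iff₀ (by positivity)] at this
      have e : (w k * g k ^ (m - 1) - w (k + 1) * g (k + 1) ^ (m - 1)) / (w k + w (k + 1)) =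
        -((w (k + 1) * g (k + 1) ^ (m - 1) - w k * g k ^ (m - 1)) / (w k + w (k + 1))) := by ring
      rw [e]
      linarith
  · obtain ⟨c, C, hc, hC, h⟩ := hW
    refine ⟨c, C, hc, hC, fun n hn => ?_⟩
    rw [Wvol_eq G N hN htree hreg o w μ hμ0 hμ1 n]
    exact h n hn
end
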